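/- Near-unit norm of the coefficient vector (Lemma A.3). Under the random features setup and the data, activation, and scaling assumptions: there exist constants c, C > 0 such that for all sufficiently large d, with probability at least 1 − 2 exp(−c log² d) over V and the data, the following holds simultaneously for every x̂ ∈ ℝ^d with ‖x̂‖_2 = √d and every a ∈ ℝⁿ with φ(x̂) = Σ_{i=1}^n a_i φ(x_i): | ‖a‖_2² − 1 | ≤ C ( √(d n / p) log d + log³ d / √d ). -/

import Mathlib

open MeasureTheory ProbabilityTheory Filter

noncomputable section

/-- Euclidean (ℓ²) norm of a vector in `Fin m → ℝ`. -/
def eNorm {m : ℕ} (x : Fin m → ℝ) : ℝ := Real.sqrt (∑ j, (x j) ^ 2)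

/-- Euclidean dot product. -/
def dotp {m : ℕ} (u v : Fin m → ℝ) : ℝ := ∑ j, u j * v j

/-- The random-features map `x ↦ (φ(vₖᵀx))ₖ`, where `vₖ` is the `k`-th row of `V`. -/
def featureMap {p d : ℕ} (φ : ℝ → ℝ) (V : Fin p → Fin d → ℝ) (x : Fin d → ℝ) :
    Fin p → ℝ := fun k => φ (dotp (V k) x)

/-- The `l`-th normalized probabilists' Hermite polynomial (orthonormal in `L²(N(0,1))`). -/
def hermiteFn (l : ℕ) (x : ℝ) : ℝ :=
  (Polynomial.aeval x (Polynomial.hermite l)) / Real.sqrt (Nat.factorial l)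

/-- The `l`-th Hermite coefficient `μ_l` of `φ`. -/
def hermiteCoeff (φ : ℝ → ℝ) (l : ℕ) : ℝ :=
  ∫ g, φ g * hermiteFn l g ∂(gaussianReal 0 1)

/-- The nonlinear part of the feature map: `φ̃(x) = (φ(vₖᵀx) − μ₁ vₖᵀx)ₖ`. -/
def tfeatureMap {p d : ℕ} (φ : ℝ → ℝ) (V : Fin p → Fin d → ℝ) (x : Fin d → ℝ) :
    Fin p → ℝ := fun k => φ (dotp (V k) x) - hermiteCoeff φ 1 * dotp (V k) x

/-- `μ̃² := Σ_{l ≥ 3} μ_l²`. -/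
def tmu2 (φ : ℝ → ℝ) : ℝ := ∑' l : ℕ, if 3 ≤ l then (hermiteCoeff φ l) ^ 2 else 0

/-- The law of the random features matrix: i.i.d. entries `N(0, 1/d)`. -/
def gaussianMatrix (p d : ℕ) : Measure (Fin p → Fin d → ℝ) :=
  Measure.pi fun _ => Measure.pi fun _ => gaussianReal 0 ((d : NNReal))⁻¹

/-- Sub-Gaussian norm of a distribution on `ℝ^d`:
`sup_{‖u‖₂ = 1} inf { t > 0 : E exp((uᵀx)²/t²) ≤ 2 }`. -/
def vecSubGNorm {d : ℕ} (P : Measure (Fin d → ℝ)) : ℝ :=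
  ⨆ u : {u : Fin d → ℝ // eNorm u = 1},
    sInf {t : ℝ | 0 < t ∧ ∫ x, Real.exp ((dotp u.1 x) ^ 2 / t ^ 2) ∂P ≤ 2}

/-- Data assumption: `P` is a probability distribution on `ℝ^d` with `‖x‖₂ = √d` a.s.
and sub-Gaussian norm at most `K`. -/
structure DataAssumption {d : ℕ} (P : Measure (Fin d → ℝ)) (K : ℝ) : Prop where
  prob : IsProbabilityMeasure P
  norm_eq : ∀ᵐ x ∂P, eNorm x = Real.sqrt d
  subg : vecSubGNorm P ≤ K

/-- Core activation assumption: `φ` is non-linear, Lipschitz, with Lipschitz derivative,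
`μ₀ = μ₂ = 0` and `μ₁ ≠ 0`. -/
structure ActivationAssumptionCore (φ : ℝ → ℝ) : Prop where
  nonlinear : ¬ ∃ a b : ℝ, ∀ z, φ z = a * z + b
  lipschitz : ∃ L : NNReal, LipschitzWith L φ
  differentiable : Differentiable ℝ φ
  deriv_lipschitz : ∃ L' : NNReal, LipschitzWith L' (deriv φ)
  mu0 : hermiteCoeff φ 0 = 0
  mu2 : hermiteCoeff φ 2 = 0
  mu1 : hermiteCoeff φ 1 ≠ 0

/-- Full activation assumption: additionally, there are two non-zero Hermite coefficients
of order ≥ 3 with different parity. -/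
structure ActivationAssumption (φ : ℝ → ℝ) extends ActivationAssumptionCore φ : Prop where
  parity : ∃ l l' : ℕ, 3 ≤ l ∧ 3 ≤ l' ∧ l % 2 ≠ l' % 2 ∧
    hermiteCoeff φ l ≠ 0 ∧ hermiteCoeff φ l' ≠ 0

/-- law of one row. -/
def rowMeas (d : ℕ) : Measure (Fin d → ℝ) :=
  Measure.pi fun _ => gaussianReal 0 ((d : NNReal))⁻¹

instance rowMeas_prob (d : ℕ) : IsProbabilityMeasure (rowMeas d) := by
  unfold rowMeas; infer_instance

theorem gaussianMatrix_eq (p d : ℕ) : gaussianMatrix p d = Measure.pi fun _ => rowMeas d := rfl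

instance gaussianMatrix_prob (p d : ℕ) : IsProbabilityMeasure (gaussianMatrix p d) := by
  rw [gaussianMatrix_eq]; infer_instance

theorem measurable_dotp {d : ℕ} {Ω : Type*} [MeasurableSpace Ω] {f g : Ω → Fin d → ℝ}
    (hf : Measurable f) (hg : Measurable g) : Measurable (fun ω => dotp (f ω) (g ω)) := by
  unfold dotp
  refine Finset.measurable_sum _ fun j _ => ?_
  exact ((measurable_pi_apply j).comp hf).mul ((measurable_pi_apply j).comp hg)

theorem row_coord_gaussian (d : ℕ) (j : Fin d) :
    HasGaussianLaw (fun v : Fin d → ℝ => v j) (rowMeas d) := by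
  have h := (measurePreserving_eval (fun _ : Fin d => gaussianReal 0 ((d : NNReal))⁻¹) j)
  refine ⟨?_⟩
  have : Measure.map (fun v : Fin d → ℝ => v j) (rowMeas d) = gaussianReal 0 ((d : NNReal))⁻¹ := h.map_eq
  rw [this]; infer_instance

theorem row_id_gaussian (d : ℕ) :
    HasGaussianLaw (fun v : Fin d → ℝ => (fun j => v j)) (rowMeas d) := by
  refine iIndepFun.hasGaussianLaw (row_coord_gaussian d) ?_
  exact iIndepFun_pi (X := fun _ (z : ℝ) => z) (fun _ => aemeasurable_id)

/-- pairing as a CLM. -/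
def dotCLM {d : ℕ} (x : Fin d → ℝ) : (Fin d → ℝ) →L[ℝ] ℝ :=
  ∑ j, x j • ContinuousLinearMap.proj j

theorem dotCLM_apply {d : ℕ} (x v : Fin d → ℝ) : dotCLM x v = dotp v x := by
  simp [dotCLM, dotp, mul_comm]

theorem row_pair_gaussian {d : ℕ} (x y : Fin d → ℝ) :
    HasGaussianLaw (fun v => (dotp v x, dotp v y)) (rowMeas d) := by
  have := (row_id_gaussian d).map_fun ((dotCLM x).prod (dotCLM y))
  simpa [dotCLM_apply] using this

theorem row_dot_memLp {d : ℕ} (x : Fin d → ℝ) : MemLp (fun v => dotp v x) 2 (rowMeas d) :=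
  (row_pair_gaussian x x).fst.memLp_two

theorem row_coord_cov {d : ℕ} (i j : Fin d) :
    cov[fun v : Fin d → ℝ => v i, fun v => v j; rowMeas d] = if i = j then (d : ℝ)⁻¹ else 0 := by
  have hm : ∀ j, MemLp (fun v : Fin d → ℝ => v j) 2 (rowMeas d) := fun j =>
    (row_coord_gaussian d j).memLp_two
  split_ifs with h
  · subst h
    rw [covariance_self (hm i).aemeasurable]
    have h := (measurePreserving_eval (fun _ : Fin d => gaussianReal 0 ((d : NNReal))⁻¹) i)
    have h2 : Var[fun v : Fin d → ℝ => v i; rowMeas d] = Var[id; (rowMeas d).map (fun v => v i)] := by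
      rw [variance_map aemeasurable_id (measurable_pi_apply i).aemeasurable]; rfl
    rw [h2]
    have : Measure.map (fun v : Fin d → ℝ => v i) (rowMeas d) = gaussianReal 0 ((d : NNReal))⁻¹ := h.map_eq
    rw [this, variance_id_gaussianReal]; simp
  · refine IndepFun.covariance_eq_zero ?_ (hm i) (hm j)
    exact (iIndepFun_pi (μ := fun _ : Fin d => gaussianReal 0 ((d : NNReal))⁻¹)
      (X := fun _ (z : ℝ) => z) (fun _ => aemeasurable_id)).indepFun h

theorem row_cov {d : ℕ} (x y : Fin d → ℝ) :
    cov[fun v => dotp v x, fun v => dotp v y; rowMeas d] = dotp x y / d := by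
  have hm : ∀ (x : Fin d → ℝ) j, MemLp (fun v : Fin d → ℝ => v j * x j) 2 (rowMeas d) := fun x j =>
    ((row_coord_gaussian d j).memLp_two).mul_const _
  unfold dotp
  rw [covariance_fun_sum_fun_sum (X := fun j (v : Fin d → ℝ) => v j * x j) (hm x) (hm y)]
  simp_rw [covariance_mul_const_left, covariance_mul_const_right, row_coord_cov]
  simp only [mul_ite, ite_mul, mul_zero, zero_mul, Finset.sum_ite_eq, Finset.mem_univ, if_true]
  rw [Finset.sum_div]
  refine Finset.sum_congr rfl fun j _ => by ring

theorem row_mean {d : ℕ} (x : Fin d → ℝ) : ∫ v, dotp v x ∂(rowMeas d) = 0 := by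
  unfold dotp
  rw [integral_finsetSum]
  · refine Finset.sum_eq_zero fun j _ => ?_
    rw [integral_mul_const]
    have h := (measurePreserving_eval (fun _ : Fin d => gaussianReal 0 ((d : NNReal))⁻¹) j)
    have : ∫ v : Fin d → ℝ, v j ∂(rowMeas d) = ∫ z, z ∂((rowMeas d).map (fun v => v j)) := by
      rw [integral_map (measurable_pi_apply j).aemeasurable (by fun_prop)]
    rw [this]
    have : Measure.map (fun v : Fin d → ℝ => v j) (rowMeas d) = gaussianReal 0 ((d : NNReal))⁻¹ := h.map_eq
    rw [this, integral_id_gaussianReal]; simp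
  · intro j _
    exact ((row_coord_gaussian d j).integrable).mul_const _

theorem row_law {d : ℕ} (x : Fin d → ℝ) :
    (rowMeas d).map (fun v => dotp v x) = gaussianReal 0 (dotp x x / d).toNNReal := by
  rw [(row_pair_gaussian x x).fst.map_eq_gaussianReal, row_mean,
    ← covariance_self (row_dot_memLp x).aemeasurable, row_cov]

theorem row_law_pair {d : ℕ} (x y : Fin d → ℝ) (hxy : dotp x y = 0) :
    (rowMeas d).map (fun v => (dotp v x, dotp v y)) =
      (gaussianReal 0 (dotp x x / d).toNNReal).prod (gaussianReal 0 (dotp y y / d).toNNReal) := by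
  have h := (row_pair_gaussian x y).indepFun_of_covariance_eq_zero (by rw [row_cov, hxy]; simp)
  rw [h.map_prod_eq_prod_map_map (row_dot_memLp x).aemeasurable (row_dot_memLp y).aemeasurable,
    row_law, row_law]

theorem dotp_self {d : ℕ} (x : Fin d → ℝ) : dotp x x = eNorm x ^ 2 := by
  unfold dotp eNorm
  rw [Real.sq_sqrt (Finset.sum_nonneg fun j _ => sq_nonneg _)]
  exact Finset.sum_congr rfl fun j _ => by ring

theorem dotp_self_sphere {d : ℕ} (x : Fin d → ℝ) (hx : eNorm x = Real.sqrt d) : dotp x x = d := by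
  rw [dotp_self, hx, Real.sq_sqrt (Nat.cast_nonneg d)]

theorem row_law_sphere {d : ℕ} (hd : 0 < d) (x : Fin d → ℝ) (hx : eNorm x = Real.sqrt d) :
    (rowMeas d).map (fun v => dotp v x) = gaussianReal 0 1 := by
  have : (d : ℝ) ≠ 0 := by positivity
  rw [row_law, dotp_self_sphere x hx, div_self this]; simp

theorem row_integral {d : ℕ} (hd : 0 < d) (x : Fin d → ℝ) (hx : eNorm x = Real.sqrt d)
    {G : ℝ → ℝ} (hG : Measurable G) :
    ∫ v, G (dotp v x) ∂(rowMeas d) = ∫ z, G z ∂(gaussianReal 0 1) := by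
  have hm : Measurable (fun v : Fin d → ℝ => dotp v x) := measurable_dotp measurable_id measurable_const
  rw [← row_law_sphere hd x hx, integral_map hm.aemeasurable hG.aestronglyMeasurable]

theorem row_integrable {d : ℕ} (hd : 0 < d) (x : Fin d → ℝ) (hx : eNorm x = Real.sqrt d)
    {G : ℝ → ℝ} (hG : Integrable G (gaussianReal 0 1)) :
    Integrable (fun v => G (dotp v x)) (rowMeas d) := by
  rw [← row_law_sphere hd x hx] at hG
  exact hG.comp_measurable (measurable_dotp measurable_id measurable_const)

/-- Gaussian shift (Cameron–Martin). -/
theorem gauss_shift {v : NNReal} (hv : v ≠ 0) (s : ℝ) (f : ℝ → ℝ) :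
    ∫ h, f (s + h) ∂(gaussianReal 0 v) =
      ∫ h, f h * Real.exp (s * h / v - s ^ 2 / (2 * v)) ∂(gaussianReal 0 v) := by
  rw [integral_gaussianReal_eq_integral_smul hv, integral_gaussianReal_eq_integral_smul hv]
  rw [← integral_add_left_eq_self (fun h => gaussianPDFReal 0 v h • (f h * Real.exp (s * h / v - s ^ 2 / (2 * v)))) s]
  congr 1; ext h
  simp only [gaussianPDFReal, smul_eq_mul, sub_zero]
  have : (v : ℝ) ≠ 0 := by exact_mod_cast hv
  have e : Real.exp (-h ^ 2 / (2 * v)) = Real.exp (-(s + h) ^ 2 / (2 * v)) * Real.exp (s * (s + h) / v - s ^ 2 / (2 * v)) := by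
    rw [← Real.exp_add]; congr 1; field_simp; ring
  rw [e]; ring

/-- exponential square integrability. -/
theorem gauss_exp_sq : Integrable (fun z : ℝ => Real.exp (z ^ 2 / 4)) (gaussianReal 0 1) := by
  rw [gaussianReal_of_var_ne_zero _ one_ne_zero]
  rw [integrable_withDensity_iff_integrable_smul' (measurable_gaussianPDF 0 1) (by simp [gaussianPDF])]
  have := (integrable_exp_neg_mul_sq (b := 1/4) (by norm_num)).const_mul ((Real.sqrt (2 * Real.pi))⁻¹)
  refine this.congr (Eventually.of_forall fun z => ?_)
  simp only [toReal_gaussianPDF, gaussianPDFReal, smul_eq_mul, NNReal.coe_one, mul_one, sub_zero]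
  rw [mul_assoc, ← Real.exp_add]; congr 2; ring

theorem exp_taylor3 (w : ℝ) : |Real.exp w - 1 - w - w ^ 2 / 2| ≤ |w| ^ 3 * Real.exp |w| := by
  have h := Complex.norm_exp_sub_sum_le_norm_mul_exp (w : ℂ) 3
  simp only [Finset.sum_range_succ, Finset.sum_range_zero] at h
  have e : (Complex.exp w - (0 + (w : ℂ) ^ 0 / (Nat.factorial 0 : ℂ) + (w : ℂ) ^ 1 / (Nat.factorial 1 : ℂ) + (w : ℂ) ^ 2 / (Nat.factorial 2 : ℂ)))
      = ((Real.exp w - 1 - w - w ^ 2 / 2 : ℝ) : ℂ) := by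
    push_cast [Nat.factorial]; ring
  rw [e, Complex.norm_real, Complex.norm_real] at h
  simpa [Real.norm_eq_abs] using h

theorem exp_taylor2 (w : ℝ) : Real.exp w ≤ 1 + w + w ^ 2 * Real.exp |w| := by
  have h := Complex.norm_exp_sub_sum_le_norm_mul_exp (w : ℂ) 2
  simp only [Finset.sum_range_succ, Finset.sum_range_zero] at h
  have e : (Complex.exp w - (0 + (w : ℂ) ^ 0 / (Nat.factorial 0 : ℂ) + (w : ℂ) ^ 1 / (Nat.factorial 1 : ℂ)))
      = ((Real.exp w - 1 - w : ℝ) : ℂ) := by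
    push_cast [Nat.factorial]; ring
  rw [e, Complex.norm_real, Complex.norm_real] at h
  simp only [Real.norm_eq_abs, sq_abs] at h
  linarith [le_abs_self (Real.exp w - 1 - w)]

/-- growth bound -/
theorem poly_exp (Q : ℝ) (hQ : 0 ≤ Q) : (2 + Q) ^ 4 ≤ 64 ^ 4 * Real.exp (Q / 16) := by
  have h1 : 2 + Q ≤ 64 * Real.exp (Q / 64) := by
    nlinarith [Real.add_one_le_exp (Q / 64)]
  calc (2 + Q) ^ 4 ≤ (64 * Real.exp (Q / 64)) ^ 4 := by gcongr
    _ = 64 ^ 4 * Real.exp (Q / 16) := by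
      rw [mul_pow, ← Real.exp_nat_mul]; congr 2; push_cast; ring

/-- the constant `E exp(g²/4)`. -/
def M4 : ℝ := ∫ z, Real.exp (z ^ 2 / 4) ∂(gaussianReal 0 1)

theorem M4_ge_one : 1 ≤ M4 := by
  have : ∫ z : ℝ, (1 : ℝ) ∂(gaussianReal 0 1) ≤ M4 :=
    integral_mono (integrable_const _) gauss_exp_sq fun z => Real.one_le_exp (by positivity)
  simpa using this

theorem gauss_map_tau (τ : NNReal) :
    (gaussianReal 0 1).map (fun z => Real.sqrt τ * z) = gaussianReal 0 τ := by
  rw [gaussianReal_map_const_mul]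
  congr 1
  · simp
  · ext; simp

theorem gauss_exp_sq_tau {τ : NNReal} (hτ : τ ≤ 1) :
    Integrable (fun z : ℝ => Real.exp (z ^ 2 / 4)) (gaussianReal 0 τ) ∧
      ∫ z, Real.exp (z ^ 2 / 4) ∂(gaussianReal 0 τ) ≤ M4 := by
  have hb : ∀ z : ℝ, Real.exp ((Real.sqrt τ * z) ^ 2 / 4) ≤ Real.exp (z ^ 2 / 4) := by
    intro z
    apply Real.exp_le_exp.mpr
    rw [mul_pow, Real.sq_sqrt τ.coe_nonneg]
    have : (τ : ℝ) ≤ 1 := by exact_mod_cast hτ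
    nlinarith [sq_nonneg z]
  have hi : Integrable (fun z : ℝ => Real.exp ((Real.sqrt τ * z) ^ 2 / 4)) (gaussianReal 0 1) := by
    refine gauss_exp_sq.mono' (by fun_prop) (Eventually.of_forall fun z => ?_)
    rw [Real.norm_eq_abs, abs_of_pos (Real.exp_pos _)]; exact hb z
  constructor
  · rw [← gauss_map_tau τ, integrable_map_measure (by fun_prop) (by fun_prop)]
    exact hi
  · rw [← gauss_map_tau τ, integral_map (by fun_prop) (by fun_prop)]
    exact integral_mono hi gauss_exp_sq hb

/-- Properties of the nonlinear part of the activation. -/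
structure GoodPsi (ψ : ℝ → ℝ) (A : ℝ) : Prop where
  meas : Measurable ψ
  nonneg : 0 ≤ A
  bound : ∀ z, |ψ z| ≤ A * (1 + |z|)
  orth0 : ∫ z, ψ z ∂(gaussianReal 0 1) = 0
  orth1 : ∫ z, ψ z * z ∂(gaussianReal 0 1) = 0
  orth2 : ∫ z, ψ z * z ^ 2 ∂(gaussianReal 0 1) = 0

theorem one_add_abs_le (z : ℝ) : (1 + |z|) ^ 2 ≤ 2 + 2 * z ^ 2 := by
  nlinarith [sq_nonneg (1 - |z|), sq_abs z]

theorem psi_poly_bound {ψ : ℝ → ℝ} {A : ℝ} (hA : 0 ≤ A) (hb : ∀ z, |ψ z| ≤ A * (1 + |z|)) (k : ℕ) (hk : k ≤ 2) (z : ℝ) :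
    |ψ z * z ^ k| ≤ A * 64 ^ 4 * Real.exp (z ^ 2 / 4) := by
  have h1 : |z| ≤ 2 + z ^ 2 := by nlinarith [sq_nonneg (|z| - 1), sq_abs z]
  have h1' : 1 + |z| ≤ 2 + z ^ 2 := by nlinarith [sq_nonneg (|z| - 1), sq_abs z]
  have h2 : 1 ≤ 2 + z ^ 2 := by nlinarith [sq_nonneg z]
  have h3 : |z| ^ k ≤ (2 + z ^ 2) ^ 2 := by
    calc |z| ^ k ≤ (2 + z ^ 2) ^ k := by gcongr
      _ ≤ _ := pow_le_pow_right₀ h2 hk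
  have h4 := poly_exp (z ^ 2) (sq_nonneg z)
  rw [abs_mul, abs_pow]
  calc |ψ z| * |z| ^ k ≤ (A * (2 + z ^ 2)) * (2 + z ^ 2) ^ 2 := by
        gcongr
        exact (hb z).trans (by gcongr)
    _ ≤ A * (2 + z ^ 2) ^ 4 := by
        have : 0 ≤ A * (2 + z ^ 2) ^ 3 := by positivity
        nlinarith
    _ ≤ A * (64 ^ 4 * Real.exp (z ^ 2 / 16)) := by gcongr
    _ ≤ _ := by
        rw [← mul_assoc]
        gcongr
        norm_num

theorem psi_poly_int {ψ : ℝ → ℝ} {A : ℝ} (hm : Measurable ψ) (hA : 0 ≤ A) (hb : ∀ z, |ψ z| ≤ A * (1 + |z|)) (k : ℕ) (hk : k ≤ 2)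
    {τ : NNReal} (hτ : τ ≤ 1) :
    Integrable (fun z => ψ z * z ^ k) (gaussianReal 0 τ) := by
  refine ((gauss_exp_sq_tau hτ).1.const_mul (A * 64 ^ 4)).mono' (by fun_prop) (Eventually.of_forall fun z => ?_)
  exact psi_poly_bound hA hb k hk z

/-- the remainder -/
def remR (ρ t g h : ℝ) : ℝ := Real.exp (ρ * g * h / t - (ρ * g) ^ 2 / (2 * t)) -
  (1 + ρ * g * h / t - ρ ^ 2 * g ^ 2 / (2 * t) + ρ ^ 2 * g ^ 2 * h ^ 2 / (2 * t ^ 2))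

theorem remR_bound (ρ t g h : ℝ) (hρ : |ρ| ≤ 1 / 8) (ht : 1 / 2 ≤ t) :
    |remR ρ t g h| ≤ |ρ| ^ 3 * (5 * (2 + (g ^ 2 + h ^ 2)) ^ 3 * Real.exp (9 / 64 * (g ^ 2 + h ^ 2))) := by
  set Q := g ^ 2 + h ^ 2 with hQ
  have hQ0 : 0 ≤ Q := by positivity
  have ht0 : 0 < t := by linarith
  set q := g * h / t - ρ * g ^ 2 / (2 * t) with hq
  set w := ρ * g * h / t - (ρ * g) ^ 2 / (2 * t) with hw
  have hwq : w = ρ * q := by rw [hw, hq]; ring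
  have hinv : 1 / t ≤ 2 := by rw [div_le_iff₀ ht0]; linarith
  have hinv0 : 0 ≤ 1 / t := by positivity
  have hgh : |g * h| ≤ Q / 2 := by rw [abs_le]; constructor <;> nlinarith [sq_nonneg (g + h), sq_nonneg (g - h)]
  have hq1 : |q| ≤ 9 / 8 * Q := by
    have e : q = (1 / t) * (g * h - ρ * g ^ 2 / 2) := by rw [hq]; field_simp
    rw [e, abs_mul, abs_of_nonneg hinv0]
    have : |g * h - ρ * g ^ 2 / 2| ≤ Q / 2 + Q / 16 := by
      refine (abs_sub _ _).trans ?_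
      have : |ρ * g ^ 2 / 2| ≤ Q / 16 := by
        rw [abs_div, abs_mul, abs_of_nonneg (sq_nonneg g), abs_two]
        nlinarith [sq_nonneg g, sq_nonneg h, abs_nonneg ρ]
      linarith
    calc 1 / t * |g * h - ρ * g ^ 2 / 2| ≤ 2 * (Q / 2 + Q / 16) := by gcongr
      _ = _ := by ring
  have hw1 : |w| ≤ 9 / 64 * Q := by
    rw [hwq, abs_mul]
    calc |ρ| * |q| ≤ 1 / 8 * (9 / 8 * Q) := by gcongr
      _ = _ := by ring
  have hT := exp_taylor3 w
  have e : remR ρ t g h = (Real.exp w - 1 - w - w ^ 2 / 2) + ρ ^ 3 * ((1/t)^2 * (- (g * h) * g ^ 2 / 2 + ρ * g ^ 4 / 8)) := by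
    simp only [remR, ← hw]
    rw [hw]; field_simp; ring
  have hX : |Real.exp w - 1 - w - w ^ 2 / 2| ≤ |ρ| ^ 3 * (2 * Q ^ 3 * Real.exp (9 / 64 * Q)) := by
    refine hT.trans ?_
    rw [show |w| ^ 3 = |ρ| ^ 3 * |q| ^ 3 by rw [hwq, abs_mul, mul_pow], mul_assoc]
    have : |q| ^ 3 ≤ 2 * Q ^ 3 := by
      calc |q| ^ 3 ≤ (9 / 8 * Q) ^ 3 := by gcongr
        _ ≤ 2 * Q ^ 3 := by rw [mul_pow]; gcongr; norm_num
    gcongr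
  have hY : |ρ ^ 3 * ((1/t)^2 * (- (g * h) * g ^ 2 / 2 + ρ * g ^ 4 / 8))| ≤ |ρ| ^ 3 * (3 * Q ^ 2) := by
    rw [abs_mul, abs_pow]
    gcongr
    rw [abs_mul, abs_of_nonneg (by positivity : (0:ℝ) ≤ (1/t)^2)]
    have hg2 : g ^ 2 ≤ Q := by nlinarith [sq_nonneg h]
    have : |- (g * h) * g ^ 2 / 2 + ρ * g ^ 4 / 8| ≤ Q ^ 2 / 4 + Q ^ 2 / 64 := by
      refine (abs_add_le _ _).trans (add_le_add ?_ ?_)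
      · rw [abs_div, abs_mul, abs_neg, abs_of_nonneg (sq_nonneg g), abs_two]
        have : |g * h| * g ^ 2 ≤ Q / 2 * Q := by gcongr
        linarith
      · rw [abs_div, abs_mul, abs_of_nonneg (by positivity : (0:ℝ) ≤ g ^ 4), abs_of_pos (by norm_num : (0:ℝ) < 8)]
        have : |ρ| * g ^ 4 ≤ 1 / 8 * (Q ^ 2) := by
          rw [show g ^ 4 = (g ^ 2) ^ 2 by ring]; gcongr
        linarith
    calc (1 / t) ^ 2 * |- (g * h) * g ^ 2 / 2 + ρ * g ^ 4 / 8| ≤ 2 ^ 2 * (Q ^ 2 / 4 + Q ^ 2 / 64) := by gcongr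
      _ ≤ 3 * Q ^ 2 := by nlinarith [sq_nonneg Q]
  rw [e]
  refine (abs_add_le _ _).trans ((add_le_add hX hY).trans ?_)
  rw [← mul_add]
  gcongr
  have h1 : 1 ≤ Real.exp (9 / 64 * Q) := Real.one_le_exp (by positivity)
  have h2 : 3 * Q ^ 2 ≤ 3 * Q ^ 2 * Real.exp (9 / 64 * Q) := le_mul_of_one_le_right (by positivity) h1
  calc _ ≤ (2 * Q ^ 3 + 3 * Q ^ 2) * Real.exp (9 / 64 * Q) := by linarith
    _ ≤ _ := by
      gcongr
      nlinarith [pow_nonneg hQ0 3, pow_nonneg hQ0 2]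

theorem psi_remR_bound {ψ : ℝ → ℝ} {A : ℝ} (hA : 0 ≤ A) (hb : ∀ z, |ψ z| ≤ A * (1 + |z|))
    (ρ t g h : ℝ) (hρ : |ρ| ≤ 1 / 8) (ht : 1 / 2 ≤ t) :
    |ψ g * (ψ h * remR ρ t g h)| ≤ (|ρ| ^ 3 * (A ^ 2 * 5 * 64 ^ 4)) * (Real.exp (g ^ 2 / 4) * Real.exp (h ^ 2 / 4)) := by
  have h1 := remR_bound ρ t g h hρ ht
  set Q := g ^ 2 + h ^ 2 with hQ
  have hQ0 : 0 ≤ Q := by positivity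
  have h2 : |ψ g| * |ψ h| ≤ A ^ 2 * (2 + Q) := by
    calc |ψ g| * |ψ h| ≤ (A * (1 + |g|)) * (A * (1 + |h|)) := by gcongr <;> apply hb
      _ = A ^ 2 * ((1 + |g|) * (1 + |h|)) := by ring
      _ ≤ _ := by
        gcongr
        nlinarith [sq_nonneg (|g| - |h|), one_add_abs_le g, one_add_abs_le h]
  have h3 := poly_exp Q hQ0
  rw [abs_mul, abs_mul, ← mul_assoc]
  calc |ψ g| * |ψ h| * |remR ρ t g h| ≤ (A ^ 2 * (2 + Q)) * (|ρ| ^ 3 * (5 * (2 + Q) ^ 3 * Real.exp (9 / 64 * Q))) := by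
        gcongr
    _ = |ρ| ^ 3 * (A ^ 2 * 5) * ((2 + Q) ^ 4 * Real.exp (9 / 64 * Q)) := by ring
    _ ≤ |ρ| ^ 3 * (A ^ 2 * 5) * ((64 ^ 4 * Real.exp (Q / 16)) * Real.exp (9 / 64 * Q)) := by gcongr
    _ = |ρ| ^ 3 * (A ^ 2 * 5) * (64 ^ 4 * Real.exp (Q / 16 + 9 / 64 * Q)) := by rw [Real.exp_add]; ring
    _ ≤ |ρ| ^ 3 * (A ^ 2 * 5) * (64 ^ 4 * Real.exp (g ^ 2 / 4 + h ^ 2 / 4)) := by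
        have : Q / 16 + 9 / 64 * Q ≤ g ^ 2 / 4 + h ^ 2 / 4 := by linarith
        have := Real.exp_le_exp.mpr this
        gcongr
    _ = _ := by rw [Real.exp_add]; ring

theorem psi_mul_int {α β : ℝ → ℝ} {A : ℝ} (hα : Measurable α) (hβ : Measurable β) (hA : 0 ≤ A)
    (hαb : ∀ z, |α z| ≤ A * (1 + |z|)) (hβb : ∀ z, |β z| ≤ A * (1 + |z|))
    {d : ℕ} (hd : 0 < d) (x y : Fin d → ℝ) (hx : eNorm x = Real.sqrt d) (hy : eNorm y = Real.sqrt d) :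
    Integrable (fun v => α (dotp v x) * β (dotp v y)) (rowMeas d) := by
  have hmx : Measurable (fun v : Fin d → ℝ => dotp v x) := measurable_dotp measurable_id measurable_const
  have hmy : Measurable (fun v : Fin d → ℝ => dotp v y) := measurable_dotp measurable_id measurable_const
  have hsq : Integrable (fun z : ℝ => 1 + z ^ 2) (gaussianReal 0 1) := by
    refine gauss_exp_sq.const_mul 4 |>.mono' (by fun_prop) (Eventually.of_forall fun z => ?_)
    rw [Real.norm_eq_abs, abs_of_pos (by positivity)]
    nlinarith [Real.add_one_le_exp (z ^ 2 / 4)]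
  have h1 := row_integrable hd x hx hsq
  have h2 := row_integrable hd y hy hsq
  refine ((h1.add h2).const_mul (A ^ 2)).mono' ((hα.comp hmx).mul (hβ.comp hmy)).aestronglyMeasurable (Eventually.of_forall fun v => ?_)
  rw [Real.norm_eq_abs, abs_mul]
  simp only [Pi.add_apply]
  set g := dotp v x
  set h := dotp v y
  calc |α g| * |β h| ≤ (A * (1 + |g|)) * (A * (1 + |h|)) := by gcongr <;> [exact hαb _; exact hβb _]
      _ = A ^ 2 * ((1 + |g|) * (1 + |h|)) := by ring
      _ ≤ _ := by
        gcongr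
        nlinarith [sq_nonneg (|g| - |h|), one_add_abs_le g, one_add_abs_le h]

theorem dotp_add_right {d : ℕ} (v x y : Fin d → ℝ) : dotp v (x + y) = dotp v x + dotp v y := by
  simp [dotp, mul_add, Finset.sum_add_distrib]
theorem dotp_smul_right {d : ℕ} (c : ℝ) (v x : Fin d → ℝ) : dotp v (c • x) = c * dotp v x := by
  simp only [dotp, Pi.smul_apply, smul_eq_mul, Finset.mul_sum]
  exact Finset.sum_congr rfl fun j _ => by ring
theorem dotp_comm {d : ℕ} (x y : Fin d → ℝ) : dotp x y = dotp y x := by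
  simp [dotp, mul_comm]

/-- orthogonal decomposition -/
theorem dotp_decomp {d : ℕ} (hd : 0 < d) (x y : Fin d → ℝ) (hx : eNorm x = Real.sqrt d)
    (hy : eNorm y = Real.sqrt d) :
    ∃ w : Fin d → ℝ, y = (dotp x y / d) • x + w ∧ dotp x w = 0 ∧ dotp w w / d = 1 - (dotp x y / d) ^ 2 := by
  have hd' : (d : ℝ) ≠ 0 := by positivity
  set ρ := dotp x y / d with hρ
  have hxy : dotp x y = ρ * d := by rw [hρ]; field_simp
  refine ⟨y + (-ρ) • x, by ext j; simp, ?_, ?_⟩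
  · rw [dotp_add_right, dotp_smul_right, dotp_self_sphere x hx, hxy]; ring
  · rw [dotp_add_right, dotp_smul_right, dotp_comm _ y, dotp_comm _ x, dotp_add_right, dotp_add_right,
      dotp_smul_right, dotp_smul_right, dotp_self_sphere x hx, dotp_self_sphere y hy, dotp_comm y x, hxy]
    field_simp; ring

theorem cross_zero {ψ : ℝ → ℝ} {A : ℝ} (hψ : GoodPsi ψ A) {d : ℕ} (hd : 0 < d) (x y : Fin d → ℝ)
    (hx : eNorm x = Real.sqrt d) (hy : eNorm y = Real.sqrt d) :
    ∫ v, dotp v y * ψ (dotp v x) ∂(rowMeas d) = 0 := by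
  have hmx : ∀ x, Measurable (fun v : Fin d → ℝ => dotp v x) := fun x => measurable_dotp measurable_id measurable_const
  obtain ⟨w, hyw, hxw, -⟩ := dotp_decomp hd x y hx hy
  set ρ := dotp x y / d
  have hind := (row_pair_gaussian x w).indepFun_of_covariance_eq_zero (by rw [row_cov, hxw]; simp)
  have hind2 : IndepFun (fun v => ψ (dotp v x)) (fun v => dotp v w) (rowMeas d) :=
    hind.comp hψ.meas measurable_id
  have hiψ : Integrable ψ (gaussianReal 0 1) := by
    simpa using psi_poly_int hψ.meas hψ.nonneg hψ.bound 0 (by norm_num) (le_refl (1 : NNReal))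
  have hiψz : Integrable (fun z => ψ z * z) (gaussianReal 0 1) := by
    simpa using psi_poly_int hψ.meas hψ.nonneg hψ.bound 1 (by norm_num) (le_refl (1 : NNReal))
  have e : ∀ v, dotp v y * ψ (dotp v x) = ρ * (ψ (dotp v x) * dotp v x) + ψ (dotp v x) * dotp v w := by
    intro v; rw [hyw, dotp_add_right, dotp_smul_right]; ring
  simp_rw [e]
  rw [integral_add, integral_const_mul, row_integral hd x hx (G := fun z => ψ z * z) (hψ.meas.mul measurable_id),
    hψ.orth1, hind2.integral_fun_mul_eq_mul_integral (hψ.meas.comp (hmx x)).aestronglyMeasurable (hmx w).aestronglyMeasurable, row_mean]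
  · simp
  · exact (row_integrable hd x hx hiψz).const_mul ρ
  · exact hind2.integrable_mul (row_integrable hd x hx hiψ) ((row_dot_memLp w).integrable (by norm_num))

theorem integral_three {Ω : Type*} [MeasurableSpace Ω] {μ : Measure Ω} {f g h : Ω → ℝ} (a b c : ℝ)
    (hf : Integrable f μ) (hg : Integrable g μ) (hh : Integrable h μ) :
    ∫ x, (a * f x + b * g x + c * h x) ∂μ = a * ∫ x, f x ∂μ + b * ∫ x, g x ∂μ + c * ∫ x, h x ∂μ := by
  have h1 : Integrable (fun x => a * f x + b * g x) μ := (hf.const_mul a).add (hg.const_mul b)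
  rw [integral_add h1 (hh.const_mul c), integral_add (hf.const_mul a) (hg.const_mul b)]
  simp_rw [integral_const_mul]

theorem third_order {ψ : ℝ → ℝ} {A : ℝ} (hψ : GoodPsi ψ A) {d : ℕ} (hd : 0 < d) (x y : Fin d → ℝ)
    (hx : eNorm x = Real.sqrt d) (hy : eNorm y = Real.sqrt d) (hρ : |dotp x y / d| ≤ 1 / 8) :
    |∫ v, ψ (dotp v x) * ψ (dotp v y) ∂(rowMeas d)| ≤ (A ^ 2 * 5 * 64 ^ 4 * M4 ^ 2) * |dotp x y / d| ^ 3 := by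
  have hd' : (d : ℝ) ≠ 0 := by positivity
  have hmx : ∀ x, Measurable (fun v : Fin d → ℝ => dotp v x) := fun x => measurable_dotp measurable_id measurable_const
  obtain ⟨w, hyw, hxw, hww⟩ := dotp_decomp hd x y hx hy
  have hIntg := psi_mul_int hψ.meas hψ.meas hψ.nonneg hψ.bound hψ.bound hd x y hx hy
  set ρ := dotp x y / d
  set τ : NNReal := (dotp w w / d).toNNReal with hτ
  have hρ2 : ρ ^ 2 ≤ 1 / 64 := by
    rw [← sq_abs]; nlinarith [abs_nonneg ρ]
  have hτv : (τ : ℝ) = 1 - ρ ^ 2 := by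
    rw [hτ, hww, Real.coe_toNNReal _ (by linarith)]
  have hτ1 : τ ≤ 1 := by
    rw [← NNReal.coe_le_coe, hτv]; simp; positivity
  have hτ2 : (1 / 2 : ℝ) ≤ τ := by rw [hτv]; linarith
  have hτ0 : τ ≠ 0 := by intro h; rw [h] at hτ2; norm_num at hτ2
  have hτ0' : (τ : ℝ) ≠ 0 := by exact_mod_cast hτ0
  have hlaw := row_law_pair x w hxw
  rw [dotp_self_sphere x hx, div_self hd', Real.toNNReal_one, ← hτ] at hlaw
  set Γ := gaussianReal 0 1 with hΓ
  set N := gaussianReal 0 τ with hN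
  have hF : Measurable (fun z : ℝ × ℝ => ψ z.1 * ψ (ρ * z.1 + z.2)) := by
    have := hψ.meas; fun_prop
  have e : (fun v => ψ (dotp v x) * ψ (dotp v y)) = (fun z : ℝ × ℝ => ψ z.1 * ψ (ρ * z.1 + z.2)) ∘ (fun v => (dotp v x, dotp v w)) := by
    ext v; simp only [Function.comp]
    conv_lhs => rw [hyw, dotp_add_right, dotp_smul_right]
  have hpm : Measurable (fun v => (dotp v x, dotp v w)) := (hmx x).prodMk (hmx w)
  have hint2 : Integrable (fun z : ℝ × ℝ => ψ z.1 * ψ (ρ * z.1 + z.2)) (Γ.prod N) := by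
    rw [← hlaw, integrable_map_measure hF.aestronglyMeasurable hpm.aemeasurable, ← e]
    exact hIntg
  have e2 : ∫ v, ψ (dotp v x) * ψ (dotp v y) ∂(rowMeas d) = ∫ g, ψ g * ∫ h, ψ (ρ * g + h) ∂N ∂Γ := by
    rw [show (∫ v, ψ (dotp v x) * ψ (dotp v y) ∂(rowMeas d)) = ∫ z, ψ z.1 * ψ (ρ * z.1 + z.2) ∂(Γ.prod N) by
      rw [← hlaw, integral_map hpm.aemeasurable hF.aestronglyMeasurable, e]; rfl]
    rw [integral_prod _ hint2]
    simp_rw [integral_const_mul]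
  have I : ∀ k ≤ 2, Integrable (fun z => ψ z * z ^ k) N := fun k hk => psi_poly_int hψ.meas hψ.nonneg hψ.bound k hk hτ1
  have J : ∀ k ≤ 2, Integrable (fun z => ψ z * z ^ k) Γ := fun k hk => psi_poly_int hψ.meas hψ.nonneg hψ.bound k hk le_rfl
  set m0 := ∫ h, ψ h * h ^ 0 ∂N with hm0
  set m1 := ∫ h, ψ h * h ^ 1 ∂N with hm1
  set m2 := ∫ h, ψ h * h ^ 2 ∂N with hm2
  have hRm : Measurable (fun z : ℝ × ℝ => ψ z.2 * remR ρ τ z.1 z.2) := by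
    have := hψ.meas; unfold remR; fun_prop
  -- bound with factor ψ g; we also need integrability of ψ h * R for each g
  have hexp : ∀ g, Integrable (fun h => ψ h * Real.exp (ρ * g * h / τ - (ρ * g) ^ 2 / (2 * τ))) N := by
    intro g
    set s := ρ * g / τ
    refine ((gauss_exp_sq_tau hτ1).1.const_mul (A * 64 ^ 4 * Real.exp (2 * s ^ 2))).mono' (by have := hψ.meas; fun_prop)
      (Eventually.of_forall fun h => ?_)
    rw [Real.norm_eq_abs, abs_mul, abs_of_pos (Real.exp_pos _)]
    have h1 : |ψ h| ≤ A * 64 ^ 4 * Real.exp (h ^ 2 / 16) := by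
      have h4 := poly_exp (h ^ 2) (sq_nonneg h)
      have h1' : 1 + |h| ≤ 2 + h ^ 2 := by nlinarith [sq_nonneg (|h| - 1), sq_abs h]
      have h2' : (2 + h ^ 2) ≤ (2 + h ^ 2) ^ 4 := le_self_pow₀ (by nlinarith [sq_nonneg h]) (by norm_num)
      refine (hψ.bound h).trans ?_
      rw [mul_assoc]
      exact mul_le_mul_of_nonneg_left (by linarith) hψ.nonneg
    have h2 : ρ * g * h / τ - (ρ * g) ^ 2 / (2 * τ) ≤ 2 * s ^ 2 + h ^ 2 / 8 := by
      have e1 : ρ * g * h / τ = s * h := by simp only [s]; ring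
      have e3 : 0 ≤ (ρ * g) ^ 2 / (2 * τ) := by positivity
      rw [e1]; nlinarith [sq_nonneg (4 * s - h), sq_nonneg h]
    calc |ψ h| * Real.exp (ρ * g * h / τ - (ρ * g) ^ 2 / (2 * τ)) ≤ (A * 64 ^ 4 * Real.exp (h ^ 2 / 16)) * Real.exp (2 * s ^ 2 + h ^ 2 / 8) := by
          have := hψ.nonneg
          gcongr
      _ = A * 64 ^ 4 * Real.exp (2 * s ^ 2) * Real.exp (h ^ 2 / 16 + h ^ 2 / 8) := by
          rw [Real.exp_add, Real.exp_add]; ring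
      _ ≤ _ := by
          have := hψ.nonneg
          have h3 : h ^ 2 / 16 + h ^ 2 / 8 ≤ h ^ 2 / 4 := by nlinarith [sq_nonneg h]
          have := Real.exp_le_exp.mpr h3
          gcongr
  set B : ℝ → ℝ := fun g => m0 * (ψ g * g ^ 0) + (ρ / τ * m1) * (ψ g * g ^ 1) + (ρ ^ 2 * (m2 / (2 * τ ^ 2) - m0 / (2 * τ))) * (ψ g * g ^ 2) with hB
  have hpolyI : ∀ g, Integrable (fun h => (1 - ρ ^ 2 * g ^ 2 / (2 * τ)) * (ψ h * h ^ 0) + (ρ * g / τ) * (ψ h * h ^ 1) + (ρ ^ 2 * g ^ 2 / (2 * τ ^ 2)) * (ψ h * h ^ 2)) N := fun g =>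
    (((I 0 (by norm_num)).const_mul _).add ((I 1 (by norm_num)).const_mul _)).add ((I 2 (by norm_num)).const_mul _)
  have hrem : ∀ g h, ψ h * remR ρ τ g h = ψ h * Real.exp (ρ * g * h / τ - (ρ * g) ^ 2 / (2 * τ)) -
      ((1 - ρ ^ 2 * g ^ 2 / (2 * τ)) * (ψ h * h ^ 0) + (ρ * g / τ) * (ψ h * h ^ 1) + (ρ ^ 2 * g ^ 2 / (2 * τ ^ 2)) * (ψ h * h ^ 2)) := by
    intro g h; simp only [remR]; ring
  have hinner : ∀ g, ψ g * ∫ h, ψ (ρ * g + h) ∂N = B g + ∫ h, ψ g * (ψ h * remR ρ τ g h) ∂N := by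
    intro g
    rw [integral_const_mul]
    simp_rw [hrem]
    rw [integral_sub (hexp g) (hpolyI g), integral_three _ _ _ (I 0 (by norm_num)) (I 1 (by norm_num)) (I 2 (by norm_num))]
    rw [← hm0, ← hm1, ← hm2, gauss_shift hτ0]
    simp only [hB]; ring
  have hBI : Integrable B Γ :=
    (((J 0 (by norm_num)).const_mul _).add ((J 1 (by norm_num)).const_mul _)).add ((J 2 (by norm_num)).const_mul _)
  have hB0 : ∫ g, B g ∂Γ = 0 := by
    simp only [hB]
    rw [integral_three _ _ _ (J 0 (by norm_num)) (J 1 (by norm_num)) (J 2 (by norm_num))]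
    simp only [pow_zero, mul_one, pow_one]
    rw [hΓ, hψ.orth0, hψ.orth1, hψ.orth2]; simp
  have hprodI : Integrable (fun z : ℝ × ℝ => (|ρ| ^ 3 * (A ^ 2 * 5 * 64 ^ 4)) * (Real.exp (z.1 ^ 2 / 4) * Real.exp (z.2 ^ 2 / 4))) (Γ.prod N) :=
    (Integrable.mul_prod gauss_exp_sq (gauss_exp_sq_tau hτ1).1).const_mul _
  have hbd : ∀ z : ℝ × ℝ, ‖ψ z.1 * (ψ z.2 * remR ρ τ z.1 z.2)‖ ≤ (|ρ| ^ 3 * (A ^ 2 * 5 * 64 ^ 4)) * (Real.exp (z.1 ^ 2 / 4) * Real.exp (z.2 ^ 2 / 4)) :=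
    fun z => psi_remR_bound hψ.nonneg hψ.bound ρ τ z.1 z.2 hρ hτ2
  have hRI : Integrable (fun z : ℝ × ℝ => ψ z.1 * (ψ z.2 * remR ρ τ z.1 z.2)) (Γ.prod N) :=
    hprodI.mono' ((hψ.meas.comp measurable_fst).mul hRm).aestronglyMeasurable (Eventually.of_forall hbd)
  rw [e2]
  simp_rw [hinner]
  rw [integral_add hBI hRI.integral_prod_left, hB0, zero_add, ← integral_prod _ hRI]
  refine (norm_integral_le_of_norm_le hprodI (Eventually.of_forall hbd)).trans ?_
  rw [integral_const_mul, integral_prod_mul (fun z : ℝ => Real.exp (z ^ 2 / 4)) (fun z : ℝ => Real.exp (z ^ 2 / 4))]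
  have h1 : ∫ z, Real.exp (z ^ 2 / 4) ∂Γ = M4 := rfl
  have h2 := (gauss_exp_sq_tau hτ1).2
  rw [h1]
  have := M4_ge_one
  calc (|ρ| ^ 3 * (A ^ 2 * 5 * 64 ^ 4)) * (M4 * ∫ z, Real.exp (z ^ 2 / 4) ∂N) ≤ (|ρ| ^ 3 * (A ^ 2 * 5 * 64 ^ 4)) * (M4 * M4) := by gcongr
    _ = _ := by ring

/-- constant in the MGF bound -/
def mgfC (θ M : ℝ) : ℝ := 8 / θ ^ 2 * Real.exp M * M

theorem mgf_bound {Ω : Type*} [MeasurableSpace Ω] {μ : Measure Ω} [IsProbabilityMeasure μ] {X : Ω → ℝ}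
    (hX : Measurable X) {θ M : ℝ} (hθ : 0 < θ) (hi : Integrable (fun ω => Real.exp (θ * |X ω|)) μ)
    (hM : ∫ ω, Real.exp (θ * |X ω|) ∂μ ≤ M) (hXi : Integrable X μ) (l : ℝ) (hl : |l| ≤ θ / 2) :
    Integrable (fun ω => Real.exp (l * (X ω - ∫ ω, X ω ∂μ))) μ ∧
    ∫ ω, Real.exp (l * (X ω - ∫ ω, X ω ∂μ)) ∂μ ≤ Real.exp (mgfC θ M * l ^ 2) := by
  set E := ∫ ω, X ω ∂μ with hE
  have hEM : θ * |E| ≤ M := by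
    have h1 : |E| ≤ ∫ ω, |X ω| ∂μ := abs_integral_le_integral_abs
    calc θ * |E| ≤ θ * ∫ ω, |X ω| ∂μ := by gcongr
      _ = ∫ ω, θ * |X ω| ∂μ := by rw [integral_const_mul]
      _ ≤ ∫ ω, Real.exp (θ * |X ω|) ∂μ := by
        refine integral_mono (hXi.abs.const_mul θ) hi fun ω => ?_
        have := Real.add_one_le_exp (θ * |X ω|); simp only; linarith
      _ ≤ M := hM
  have habs : ∀ ω, θ * |X ω - E| ≤ M + θ * |X ω| := by
    intro ω
    have : |X ω - E| ≤ |X ω| + |E| := abs_sub _ _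
    nlinarith
  have hdom : ∀ ω, Real.exp (θ * |X ω - E|) ≤ Real.exp M * Real.exp (θ * |X ω|) := fun ω => by
    rw [← Real.exp_add]; exact Real.exp_le_exp.mpr (habs ω)
  have hle : ∀ ω, |l * (X ω - E)| ≤ θ / 2 * |X ω - E| := fun ω => by
    rw [abs_mul]; gcongr
  have hIntg : Integrable (fun ω => Real.exp (l * (X ω - E))) μ := by
    refine (hi.const_mul (Real.exp M)).mono' (by fun_prop) (Eventually.of_forall fun ω => ?_)
    rw [Real.norm_eq_abs, abs_of_pos (Real.exp_pos _)]
    refine le_trans (Real.exp_le_exp.mpr ?_) (hdom ω)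
    have := (le_abs_self _).trans (hle ω)
    nlinarith [abs_nonneg (X ω - E)]
  refine ⟨hIntg, ?_⟩
  have hpt : ∀ ω, Real.exp (l * (X ω - E)) ≤ 1 + l * (X ω - E) + (l ^ 2 * (8 / θ ^ 2) * Real.exp M) * Real.exp (θ * |X ω|) := by
    intro ω
    set y := X ω - E with hy
    have h1 := exp_taylor2 (l * y)
    have h2 : Real.exp |l * y| ≤ Real.exp (θ / 2 * |y|) := Real.exp_le_exp.mpr (hle ω)
    have h3 : y ^ 2 ≤ 8 / θ ^ 2 * Real.exp (θ / 2 * |y|) := by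
      have := Real.quadratic_le_exp_of_nonneg (x := θ / 2 * |y|) (by positivity)
      have h4 : 0 ≤ θ / 2 * |y| := by positivity
      rw [div_mul_eq_mul_div, le_div_iff₀ (by positivity)]
      nlinarith [sq_abs y]
    have h5 : (l * y) ^ 2 * Real.exp |l * y| ≤ (l ^ 2 * (8 / θ ^ 2) * Real.exp M) * Real.exp (θ * |X ω|) := by
      calc (l * y) ^ 2 * Real.exp |l * y| ≤ (l ^ 2 * (8 / θ ^ 2 * Real.exp (θ / 2 * |y|))) * Real.exp (θ / 2 * |y|) := by
            rw [mul_pow]; gcongr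
        _ = l ^ 2 * (8 / θ ^ 2) * Real.exp (θ * |y|) := by
            rw [show θ * |y| = θ / 2 * |y| + θ / 2 * |y| by ring, Real.exp_add]; ring
        _ ≤ l ^ 2 * (8 / θ ^ 2) * (Real.exp M * Real.exp (θ * |X ω|)) := by gcongr; exact hdom ω
        _ = _ := by ring
    linarith
  have hYi : Integrable (fun ω => l * (X ω - E)) μ := (hXi.sub (integrable_const E)).const_mul l
  have hY0 : ∫ ω, l * (X ω - E) ∂μ = 0 := by
    rw [integral_const_mul, integral_sub hXi (integrable_const E)]; simp [hE]
  have h1Y : Integrable (fun ω => 1 + l * (X ω - E)) μ := (integrable_const 1).add hYi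
  calc ∫ ω, Real.exp (l * (X ω - E)) ∂μ ≤ ∫ ω, (1 + l * (X ω - E) + (l ^ 2 * (8 / θ ^ 2) * Real.exp M) * Real.exp (θ * |X ω|)) ∂μ :=
        integral_mono hIntg (h1Y.add (hi.const_mul _)) hpt
    _ = 1 + (l ^ 2 * (8 / θ ^ 2) * Real.exp M) * ∫ ω, Real.exp (θ * |X ω|) ∂μ := by
        rw [integral_add h1Y (hi.const_mul _), integral_add (integrable_const 1) hYi, hY0, integral_const_mul]; simp
    _ ≤ 1 + (l ^ 2 * (8 / θ ^ 2) * Real.exp M) * M := by gcongr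
    _ = mgfC θ M * l ^ 2 + 1 := by unfold mgfC; ring
    _ ≤ _ := Real.add_one_le_exp _

theorem chernoff_pi {Ω : Type*} [MeasurableSpace Ω] {μ : Measure Ω} [IsProbabilityMeasure μ] {Y : Ω → ℝ}
    (p : ℕ) {C θ : ℝ} (hC : 0 < C) 
    (h : ∀ l, |l| ≤ θ / 2 → Integrable (fun ω => Real.exp (l * Y ω)) μ ∧ ∫ ω, Real.exp (l * Y ω) ∂μ ≤ Real.exp (C * l ^ 2))
    (t : ℝ) (ht0 : 0 ≤ t) (ht : t ≤ C * θ) :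
    (Measure.pi fun _ : Fin p => μ) {V | p * t ≤ ∑ k, Y (V k)} ≤ ENNReal.ofReal (Real.exp (-(p * t ^ 2 / (4 * C)))) := by
  set l := t / (2 * C) with hl
  have hl0 : 0 ≤ l := by positivity
  have hlb : |l| ≤ θ / 2 := by
    rw [abs_of_nonneg hl0, hl, div_le_iff₀ (by positivity)]; nlinarith
  obtain ⟨hi, hle⟩ := h l hlb
  have e : (fun V : Fin p → Ω => Real.exp (l * ∑ k, Y (V k))) = fun V => ∏ k, Real.exp (l * Y (V k)) := by
    ext V; rw [Finset.mul_sum, Real.exp_sum]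
  have hI : Integrable (fun V : Fin p → Ω => Real.exp (l * ∑ k, Y (V k))) (Measure.pi fun _ : Fin p => μ) := by
    rw [e]; exact Integrable.fintype_prod (f := fun _ ω => Real.exp (l * Y ω)) (fun _ => hi)
  have h1 := measure_ge_le_exp_mul_mgf (p * t) hl0 hI
  have h2 : mgf (fun V : Fin p → Ω => ∑ k, Y (V k)) (Measure.pi fun _ : Fin p => μ) l ≤ Real.exp (p * (C * l ^ 2)) := by
    unfold mgf
    rw [e, integral_fintype_prod_eq_prod (fun _ ω => Real.exp (l * Y ω))]
    rw [Finset.prod_const, Finset.card_univ, Fintype.card_fin, Real.exp_nat_mul]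
    gcongr
  rw [← ofReal_measureReal]
  apply ENNReal.ofReal_le_ofReal
  refine h1.trans ((mul_le_mul_of_nonneg_left h2 (Real.exp_pos _).le).trans ?_)
  rw [← Real.exp_add]
  apply Real.exp_le_exp.mpr
  rw [hl]; apply le_of_eq; field_simp; ring

theorem row_exp_bound {α β : ℝ → ℝ} {A : ℝ} (hα : Measurable α) (hβ : Measurable β) (hA : 0 < A)
    (hαb : ∀ z, |α z| ≤ A * (1 + |z|)) (hβb : ∀ z, |β z| ≤ A * (1 + |z|))
    {d : ℕ} (hd : 0 < d) (x y : Fin d → ℝ) (hx : eNorm x = Real.sqrt d) (hy : eNorm y = Real.sqrt d) :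
    Integrable (fun v => Real.exp (1 / (8 * A ^ 2) * |α (dotp v x) * β (dotp v y)|)) (rowMeas d) ∧
    ∫ v, Real.exp (1 / (8 * A ^ 2) * |α (dotp v x) * β (dotp v y)|) ∂(rowMeas d) ≤ 2 * M4 := by
  have hmx : ∀ x, Measurable (fun v : Fin d → ℝ => dotp v x) := fun x => measurable_dotp measurable_id measurable_const
  have hpt : ∀ v : Fin d → ℝ, Real.exp (1 / (8 * A ^ 2) * |α (dotp v x) * β (dotp v y)|) ≤
      Real.exp ((dotp v x) ^ 2 / 4) + Real.exp ((dotp v y) ^ 2 / 4) := by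
    intro v
    set g := dotp v x
    set h := dotp v y
    have h1 : |α g * β h| ≤ A ^ 2 * (2 + g ^ 2 + h ^ 2) := by
      rw [abs_mul]
      calc |α g| * |β h| ≤ (A * (1 + |g|)) * (A * (1 + |h|)) := by gcongr <;> [exact hαb _; exact hβb _]
      _ = A ^ 2 * ((1 + |g|) * (1 + |h|)) := by ring
      _ ≤ _ := by
        gcongr
        nlinarith [sq_nonneg (|g| - |h|), one_add_abs_le g, one_add_abs_le h]
    have h2 : 1 / (8 * A ^ 2) * |α g * β h| ≤ (g ^ 2 / 4) / 2 + (h ^ 2 / 4) / 2 + 1 / 4 := by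
      calc _ ≤ 1 / (8 * A ^ 2) * (A ^ 2 * (2 + g ^ 2 + h ^ 2)) := by gcongr
        _ = _ := by field_simp; ring
    refine (Real.exp_le_exp.mpr h2).trans ?_
    rw [Real.exp_add, Real.exp_add]
    set a := Real.exp (g ^ 2 / 4 / 2)
    set b := Real.exp (h ^ 2 / 4 / 2)
    have ea : Real.exp (g ^ 2 / 4) = a ^ 2 := by rw [← Real.exp_nat_mul]; congr 1; push_cast; ring
    have eb : Real.exp (h ^ 2 / 4) = b ^ 2 := by rw [← Real.exp_nat_mul]; congr 1; push_cast; ring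
    rw [ea, eb]
    have h4 : Real.exp (1 / 4) ≤ 2 := by
      have h5 : Real.exp (1 / 4) ≤ Real.exp (Real.log 2) := Real.exp_le_exp.mpr (by linarith [Real.log_two_gt_d9])
      rwa [Real.exp_log (by norm_num)] at h5
    have : 0 ≤ a * b := by positivity
    nlinarith [sq_nonneg (a - b)]
  have hI : Integrable (fun v : Fin d → ℝ => Real.exp ((dotp v x) ^ 2 / 4) + Real.exp ((dotp v y) ^ 2 / 4)) (rowMeas d) :=
    (row_integrable hd x hx gauss_exp_sq).add (row_integrable hd y hy gauss_exp_sq)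
  have hI2 : Integrable (fun v => Real.exp (1 / (8 * A ^ 2) * |α (dotp v x) * β (dotp v y)|)) (rowMeas d) := by
    refine hI.mono' ?_ (Eventually.of_forall fun v => ?_)
    · have := hmx x; have := hmx y; fun_prop
    · rw [Real.norm_eq_abs, abs_of_pos (Real.exp_pos _)]; exact hpt v
  refine ⟨hI2, (integral_mono hI2 hI hpt).trans ?_⟩
  rw [integral_add (row_integrable hd x hx gauss_exp_sq) (row_integrable hd y hy gauss_exp_sq),
    row_integral hd x hx (G := fun z => Real.exp (z ^ 2 / 4)) (by fun_prop), row_integral hd y hy (G := fun z => Real.exp (z ^ 2 / 4)) (by fun_prop)]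
  unfold M4; linarith

/-- empirical correlation sum -/
def Ssum {p d : ℕ} (α β : ℝ → ℝ) (V : Fin p → Fin d → ℝ) (x y : Fin d → ℝ) : ℝ :=
  ∑ k, α (dotp (V k) x) * β (dotp (V k) y)

def Emean (d : ℕ) (α β : ℝ → ℝ) (x y : Fin d → ℝ) : ℝ :=
  ∫ v, α (dotp v x) * β (dotp v y) ∂(rowMeas d)

theorem bernstein_rf (A : ℝ) (hA : 0 < A) : ∃ c > 0, ∃ t₀ > 0, ∀ α β : ℝ → ℝ, Measurable α → Measurable β →
    (∀ z, |α z| ≤ A * (1 + |z|)) → (∀ z, |β z| ≤ A * (1 + |z|)) →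
    ∀ (d p : ℕ), 0 < d → 0 < p → ∀ x y : Fin d → ℝ, eNorm x = Real.sqrt d → eNorm y = Real.sqrt d →
    ∀ t, 0 ≤ t → t ≤ t₀ →
    gaussianMatrix p d {V | t ≤ |Ssum α β V x y / p - Emean d α β x y|} ≤
      ENNReal.ofReal (2 * Real.exp (-(c * (p * t ^ 2)))) := by
  set θ := 1 / (8 * A ^ 2) with hθ
  have hθ0 : 0 < θ := by positivity
  have hM4 := M4_ge_one
  set C := mgfC θ (2 * M4) with hC
  have hC0 : 0 < C := by rw [hC]; unfold mgfC; positivity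
  refine ⟨1 / (4 * C), by positivity, C * θ, by positivity, ?_⟩
  intro α β hα hβ hαb hβb d p hd hp x y hx hy t ht0 ht
  have hmx : ∀ x, Measurable (fun v : Fin d → ℝ => dotp v x) := fun x => measurable_dotp measurable_id measurable_const
  set X : (Fin d → ℝ) → ℝ := fun v => α (dotp v x) * β (dotp v y) with hX
  have hXm : Measurable X := (hα.comp (hmx x)).mul (hβ.comp (hmx y))
  obtain ⟨hi, hM⟩ := row_exp_bound hα hβ hA hαb hβb hd x y hx hy
  have hXi : Integrable X (rowMeas d) := psi_mul_int hα hβ hA.le hαb hβb hd x y hx hy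
  have hmgf := fun l hl => mgf_bound hXm hθ0 hi hM hXi l hl
  set E := Emean d α β x y with hE
  have hE' : ∫ v, X v ∂(rowMeas d) = E := rfl
  rw [hE'] at hmgf
  have h1 := chernoff_pi p (Y := fun v => X v - E) hC0 hmgf t ht0 ht
  have h2 := chernoff_pi p (Y := fun v => -(X v - E)) (μ := rowMeas d) (θ := θ) hC0 (fun l hl => by
    have := hmgf (-l) (by rwa [abs_neg])
    have e : ∀ v, l * -(X v - E) = -l * (X v - E) := fun v => by ring
    simp only [e]
    rw [neg_sq] at this
    exact this) t ht0 ht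
  have hp' : (0 : ℝ) < p := by exact_mod_cast hp
  have hsub : {V : Fin p → Fin d → ℝ | t ≤ |Ssum α β V x y / p - E|} ⊆
      {V | p * t ≤ ∑ k, (X (V k) - E)} ∪ {V | p * t ≤ ∑ k, -(X (V k) - E)} := by
    intro V hV
    have e : Ssum α β V x y / p - E = (∑ k, (X (V k) - E)) / p := by
      rw [Finset.sum_sub_distrib]; simp [Ssum, hX]; field_simp
    simp only [Set.mem_ofPred_eq, e, abs_div, abs_of_pos hp', le_div_iff₀ hp'] at hV
    simp only [Set.mem_union, Set.mem_ofPred_eq, Finset.sum_neg_distrib]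
    rcases le_abs.mp hV with h | h
    · left; linarith
    · right; linarith
  refine (measure_mono hsub).trans ((measure_union_le _ _).trans ((add_le_add h1 h2).trans ?_))
  rw [← ENNReal.ofReal_add (Real.exp_pos _).le (Real.exp_pos _).le]
  apply ENNReal.ofReal_le_ofReal
  rw [← two_mul]
  apply le_of_eq; congr 3; field_simp

def psiF (φ : ℝ → ℝ) : ℝ → ℝ := fun z => φ z - hermiteCoeff φ 1 * z

theorem hermiteFn_zero (z : ℝ) : hermiteFn 0 z = 1 := by simp [hermiteFn]
theorem hermiteFn_one (z : ℝ) : hermiteFn 1 z = z := by simp [hermiteFn]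
theorem hermiteFn_two (z : ℝ) : hermiteFn 2 z = (z ^ 2 - 1) / Real.sqrt 2 := by
  simp [hermiteFn, Polynomial.hermite_succ]; ring_nf

theorem gauss_z2 : ∫ z : ℝ, z ^ 2 ∂(gaussianReal 0 1) = 1 := by
  have h := variance_id_gaussianReal (μ := 0) (v := 1)
  rw [variance_of_integral_eq_zero (by fun_prop) (by simp)] at h
  simpa using h

theorem gauss_z3 : ∫ z : ℝ, z * z ^ 2 ∂(gaussianReal 0 1) = 0 := by
  have h : (gaussianReal 0 1).map (fun z : ℝ => -z) = gaussianReal 0 1 := by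
    rw [gaussianReal_map_neg]; simp
  have h2 : ∫ z : ℝ, z * z ^ 2 ∂(gaussianReal 0 1) = ∫ z : ℝ, (-z) * (-z) ^ 2 ∂(gaussianReal 0 1) := by
    conv_lhs => rw [← h]
    rw [integral_map (by fun_prop) (by fun_prop)]
  have h3 : ∫ z : ℝ, (-z) * (-z) ^ 2 ∂(gaussianReal 0 1) = - ∫ z : ℝ, z * z ^ 2 ∂(gaussianReal 0 1) := by
    rw [← integral_neg]; congr 1; ext z; ring
  linarith

theorem psi_facts {φ : ℝ → ℝ} (hφ : ActivationAssumptionCore φ) :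
    ∃ A : ℝ, 1 ≤ A ∧ GoodPsi (psiF φ) A ∧ (∀ y z, |psiF φ y - psiF φ z| ≤ A * |y - z|) ∧
      0 < ∫ z, psiF φ z * psiF φ z ∂(gaussianReal 0 1) := by
  obtain ⟨L, hL⟩ := hφ.lipschitz
  set μ := hermiteCoeff φ 1 with hμ
  set A : ℝ := 1 + L + |μ| + |φ 0| with hA
  have hL0 : (0 : ℝ) ≤ L := L.2
  have hA1 : 1 ≤ A := by have := abs_nonneg μ; have := abs_nonneg (φ 0); linarith
  have hφb : ∀ z, |φ z| ≤ A * (1 + |z|) := by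
    intro z
    have h1 : |φ z - φ 0| ≤ L * |z - 0| := by
      have := hL.dist_le_mul z 0
      rwa [Real.dist_eq, Real.dist_eq] at this
    rw [sub_zero] at h1
    have h2 := abs_sub_abs_le_abs_sub (φ z) (φ 0)
    have := abs_nonneg μ; have := abs_nonneg (φ 0); have := abs_nonneg z
    have h3 : L * |z| ≤ A * |z| := by gcongr; linarith
    rw [mul_add, mul_one]; linarith
  have hlip : ∀ y z, |psiF φ y - psiF φ z| ≤ A * |y - z| := by
    intro y z
    have h1 : |φ y - φ z| ≤ L * |y - z| := by
      have := hL.dist_le_mul y z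
      rwa [Real.dist_eq, Real.dist_eq] at this
    have e : psiF φ y - psiF φ z = (φ y - φ z) - μ * (y - z) := by unfold psiF; ring
    rw [e]
    refine (abs_sub _ _).trans ?_
    rw [abs_mul]
    have h3 : (L + |μ|) * |y - z| ≤ A * |y - z| := by
      gcongr; have := abs_nonneg (φ 0); linarith
    linarith
  have hb : ∀ z, |psiF φ z| ≤ A * (1 + |z|) := by
    intro z
    have h1 := hlip z 0
    have h2 := abs_sub_abs_le_abs_sub (psiF φ z) (psiF φ 0)
    have h3 : psiF φ 0 = φ 0 := by simp [psiF]
    rw [h3] at h1 h2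
    rw [sub_zero] at h1
    have := abs_nonneg μ
    rw [mul_add, mul_one]; linarith
  have hφc : Continuous φ := hL.continuous
  have hψc : Continuous (psiF φ) := by unfold psiF; fun_prop
  have hA0 : 0 ≤ A := by linarith
  have Iφ := fun k hk => psi_poly_int (τ := 1) hφc.measurable hA0 hφb k hk le_rfl
  have Iz := fun k hk => psi_poly_int (ψ := fun z => z) (τ := 1) measurable_id hA0
    (fun z => by have := abs_nonneg z; nlinarith) k hk le_rfl
  have key : ∀ k, k ≤ 2 → ∫ z, psiF φ z * z ^ k ∂(gaussianReal 0 1) =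
      ∫ z, φ z * z ^ k ∂(gaussianReal 0 1) - μ * ∫ z, z * z ^ k ∂(gaussianReal 0 1) := by
    intro k hk
    rw [← integral_const_mul, ← integral_sub (Iφ k hk) ((Iz k hk).const_mul μ)]
    congr 1; ext z; unfold psiF; ring
  have e0 : ∫ z, φ z ∂(gaussianReal 0 1) = 0 := by
    have := hφ.mu0; unfold hermiteCoeff at this; simpa [hermiteFn_zero] using this
  have e1 : ∫ z, φ z * z ∂(gaussianReal 0 1) = μ := by
    rw [hμ]; unfold hermiteCoeff; simp [hermiteFn_one]
  have e2 : ∫ z, φ z * z ^ 2 ∂(gaussianReal 0 1) = 0 := by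
    have := hφ.mu2; unfold hermiteCoeff at this
    have e : ∀ z, φ z * hermiteFn 2 z = (φ z * z ^ 2 - φ z * z ^ 0) * (Real.sqrt 2)⁻¹ := by
      intro z; rw [hermiteFn_two]; field_simp
    simp_rw [e] at this
    rw [integral_mul_const, integral_sub (Iφ 2 le_rfl) (Iφ 0 (by norm_num))] at this
    simp [e0] at this
    exact this
  have z1 : ∫ z : ℝ, z ∂(gaussianReal 0 1) = 0 := by simp
  have o0 := key 0 (by norm_num)
  have o1 := key 1 (by norm_num)
  have o2 := key 2 le_rfl
  simp only [pow_zero, mul_one, pow_one] at o0 o1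
  have z2 : ∫ z : ℝ, z * z ∂(gaussianReal 0 1) = 1 := by rw [← gauss_z2]; congr 1; ext z; ring
  rw [e0, z1] at o0
  rw [e1, z2] at o1
  rw [e2, gauss_z3] at o2
  refine ⟨A, hA1, ⟨hψc.measurable, hA0, hb, by linarith, by linarith, by linarith⟩, hlip, ?_⟩
  have hnn : 0 ≤ ∫ z, psiF φ z * psiF φ z ∂(gaussianReal 0 1) := integral_nonneg fun z => mul_self_nonneg _
  rcases hnn.lt_or_eq with h | h
  · exact h
  exfalso
  have hIntg : Integrable (fun z => psiF φ z * psiF φ z) (gaussianReal 0 1) := by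
    refine ((Iz 1 (by norm_num)).const_mul (2 * A ^ 2) |>.add (integrable_const (2 * A ^ 2))).mono' (by fun_prop)
      (Eventually.of_forall fun z => ?_)
    rw [Real.norm_eq_abs, abs_mul]
    have h1 := hb z
    have h2 := one_add_abs_le z
    have h3 : |psiF φ z| * |psiF φ z| ≤ (A * (1 + |z|)) * (A * (1 + |z|)) := by gcongr
    simp only [Pi.add_apply, pow_one]
    nlinarith [mul_le_mul_of_nonneg_left h2 (sq_nonneg A)]
  have hae := (integral_eq_zero_iff_of_nonneg (fun z => mul_self_nonneg (psiF φ z)) hIntg).mp h.symm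
  have hae2 : (fun z => psiF φ z * psiF φ z) =ᵐ[volume] 0 :=
    (gaussianReal_absolutelyContinuous' 0 (by norm_num : (1 : NNReal) ≠ 0)).ae_eq hae
  have heq := (Continuous.ae_eq_iff_eq volume (by fun_prop) continuous_zero).mp hae2
  apply hφ.nonlinear
  refine ⟨μ, 0, fun z => ?_⟩
  have := congrFun heq z
  simp only [Pi.zero_apply, mul_self_eq_zero] at this
  unfold psiF at this
  linarith

theorem emean_diag {ψ : ℝ → ℝ} (hm : Measurable ψ) {d : ℕ} (hd : 0 < d) (x : Fin d → ℝ)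
    (hx : eNorm x = Real.sqrt d) :
    Emean d ψ ψ x x = ∫ z, ψ z * ψ z ∂(gaussianReal 0 1) :=
  row_integral hd x hx (G := fun z => ψ z * ψ z) (hm.mul hm)

theorem emean_id {d : ℕ} (hd : 0 < d) (x : Fin d → ℝ)
    (hx : eNorm x = Real.sqrt d) :
    Emean d (fun z => z) (fun z => z) x x = 1 := by
  rw [emean_diag measurable_id' hd x hx, ← gauss_z2]; congr 1; ext z; ring

theorem emean_cross {ψ : ℝ → ℝ} {A : ℝ} (hψ : GoodPsi ψ A) {d : ℕ} (hd : 0 < d) (x y : Fin d → ℝ)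
    (hx : eNorm x = Real.sqrt d) (hy : eNorm y = Real.sqrt d) :
    Emean d (fun z => z) ψ y x = 0 := cross_zero hψ hd x y hx hy

theorem eNorm_nonneg {d : ℕ} (x : Fin d → ℝ) : 0 ≤ eNorm x := Real.sqrt_nonneg _

theorem dotp_cs {d : ℕ} (x y : Fin d → ℝ) : |dotp x y| ≤ eNorm x * eNorm y := by
  rw [← Real.sqrt_sq_eq_abs, eNorm, eNorm, ← Real.sqrt_mul (Finset.sum_nonneg fun j _ => sq_nonneg _)]
  exact Real.sqrt_le_sqrt (Finset.sum_mul_sq_le_sq_mul_sq _ _ _)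

theorem dotp_sub_right {d : ℕ} (v x y : Fin d → ℝ) : dotp v x - dotp v y = dotp v (x - y) := by
  simp [dotp, mul_sub, Finset.sum_sub_distrib]

theorem abs_le_eNorm {d : ℕ} (x : Fin d → ℝ) (j : Fin d) : |x j| ≤ eNorm x := by
  rw [← Real.sqrt_sq_eq_abs, eNorm]
  exact Real.sqrt_le_sqrt (Finset.single_le_sum (f := fun j => x j ^ 2) (fun j _ => sq_nonneg _) (Finset.mem_univ j))

theorem eNorm_le_of_abs_le {d : ℕ} (x : Fin d → ℝ) (ε : ℝ) (hε : 0 ≤ ε) (h : ∀ j, |x j| ≤ ε) :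
    eNorm x ≤ Real.sqrt d * ε := by
  have h1 : ∑ j, x j ^ 2 ≤ d * ε ^ 2 := by
    calc ∑ j, x j ^ 2 ≤ ∑ j : Fin d, ε ^ 2 := by
          refine Finset.sum_le_sum fun j _ => ?_
          rw [← sq_abs (x j)]; exact pow_le_pow_left₀ (abs_nonneg _) (h j) 2
      _ = d * ε ^ 2 := by simp
  rw [eNorm]
  refine (Real.sqrt_le_sqrt h1).trans ?_
  rw [Real.sqrt_mul (Nat.cast_nonneg d), Real.sqrt_sq hε]

theorem net_exists (d : ℕ) (hd : 3 ≤ d) : ∃ N : Finset (Fin d → ℝ), (∀ x ∈ N, eNorm x = Real.sqrt d) ∧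
    (N.card : ℝ) ≤ (d : ℝ) ^ (5 * d) ∧
    ∀ x : Fin d → ℝ, eNorm x = Real.sqrt d → ∃ y ∈ N, eNorm (x - y) ≤ 1 / (d : ℝ) ^ 2 := by
  classical
  have hd3 : (3 : ℝ) ≤ d := by exact_mod_cast hd
  set G : Finset (Fin d → ℤ) := Fintype.piFinset fun _ => Finset.Icc (-(d : ℤ) ^ 4) ((d : ℤ) ^ 4) with hG
  set g : (Fin d → ℝ) → (Fin d → ℤ) := fun x j => ⌊(d : ℝ) ^ 3 * x j⌋ with hg
  set rep : (Fin d → ℤ) → (Fin d → ℝ) := fun c =>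
    if h : ∃ x, eNorm x = Real.sqrt d ∧ g x = c then h.choose else fun _ => 1 with hrep
  have hsqd : Real.sqrt d ≤ d := by
    rw [Real.sqrt_le_left (by linarith)]; nlinarith
  refine ⟨G.image rep, ?_, ?_, ?_⟩
  · intro x hx
    obtain ⟨c, -, rfl⟩ := Finset.mem_image.mp hx
    simp only [hrep]
    split_ifs with h
    · exact h.choose_spec.1
    · simp [eNorm]
  · have h1 : (G.image rep).card ≤ (2 * d ^ 4 + 1) ^ d := by
      refine Finset.card_image_le.trans ?_
      rw [hG, Fintype.card_piFinset]
      simp only [Int.card_Icc, Finset.prod_const, Finset.card_univ, Fintype.card_fin]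
      apply Nat.pow_le_pow_left
      zify
      rw [Int.toNat_of_nonneg (by have : (0:ℤ) ≤ (d:ℤ)^4 := by positivity
                                  linarith)]
      linarith
    have h2 : 2 * d ^ 4 + 1 ≤ d ^ 5 := by
      have : 1 ≤ d ^ 4 := Nat.one_le_pow _ _ (by omega)
      calc 2 * d ^ 4 + 1 ≤ 3 * d ^ 4 := by omega
        _ ≤ d * d ^ 4 := by gcongr
        _ = d ^ 5 := by ring
    have h3 := h1.trans (Nat.pow_le_pow_left h2 d)
    rw [← pow_mul] at h3
    exact_mod_cast h3
  · intro x hx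
    have hgx : g x ∈ G := by
      rw [hG, Fintype.mem_piFinset]
      intro j
      have h1 := (abs_le_eNorm x j).trans (hx.le.trans hsqd)
      rw [abs_le] at h1
      have hd0 : (0 : ℝ) ≤ (d : ℝ) ^ 3 := by positivity
      rw [Finset.mem_Icc]
      constructor
      · rw [Int.le_floor]; push_cast
        nlinarith [mul_le_mul_of_nonneg_left h1.1 hd0]
      · have : (⌊(d : ℝ) ^ 3 * x j⌋ : ℝ) ≤ (d : ℝ) ^ 4 := by
          refine (Int.floor_le _).trans ?_
          nlinarith [mul_le_mul_of_nonneg_left h1.2 hd0]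
        change ⌊(d : ℝ) ^ 3 * x j⌋ ≤ (d : ℤ) ^ 4
        rw [← Int.cast_le (R := ℝ)]; push_cast; exact this
    refine ⟨rep (g x), Finset.mem_image_of_mem _ hgx, ?_⟩
    have hex : ∃ y, eNorm y = Real.sqrt d ∧ g y = g x := ⟨x, hx, rfl⟩
    have hr : g (rep (g x)) = g x := by
      simp only [hrep]
      rw [dif_pos hex]
      exact hex.choose_spec.2
    set y := rep (g x)
    have hcoord : ∀ j, |(x - y) j| ≤ 1 / (d : ℝ) ^ 3 := by
      intro j
      have h1 := Int.abs_sub_lt_one_of_floor_eq_floor (congrFun hr j).symm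
      rw [← mul_sub, abs_mul, abs_of_pos (by positivity : (0 : ℝ) < (d : ℝ) ^ 3)] at h1
      rw [le_div_iff₀ (by positivity), mul_comm]
      exact h1.le
    refine (eNorm_le_of_abs_le _ _ (by positivity) hcoord).trans ?_
    rw [mul_one_div, div_le_div_iff₀ (by positivity) (by positivity)]
    nlinarith [mul_le_mul_of_nonneg_right hsqd (by positivity : (0 : ℝ) ≤ (d : ℝ) ^ 2)]

/-- union bound over finitely many pairs -/
theorem union_rf {ι : Type*} (s : Finset ι) {p d : ℕ} (α β : ℝ → ℝ) (x y : ι → Fin d → ℝ) (t B : ℝ)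
    (h : ∀ i ∈ s, gaussianMatrix p d {V | t ≤ |Ssum α β V (x i) (y i) / p - Emean d α β (x i) (y i)|} ≤
      ENNReal.ofReal B) :
    gaussianMatrix p d {V | ∃ i ∈ s, t ≤ |Ssum α β V (x i) (y i) / p - Emean d α β (x i) (y i)|} ≤
      ENNReal.ofReal (s.card * B) := by
  have e : {V : Fin p → Fin d → ℝ | ∃ i ∈ s, t ≤ |Ssum α β V (x i) (y i) / p - Emean d α β (x i) (y i)|} =
      ⋃ i ∈ s, {V | t ≤ |Ssum α β V (x i) (y i) / p - Emean d α β (x i) (y i)|} := by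
    ext V; simp
  rw [e]
  refine (measure_biUnion_finset_le _ _).trans ((Finset.sum_le_sum h).trans ?_)
  rw [Finset.sum_const, nsmul_eq_mul, ENNReal.ofReal_mul (Nat.cast_nonneg _)]
  simp

def basisV {d : ℕ} (j : Fin d) : Fin d → ℝ := Pi.single j (Real.sqrt d)

theorem basisV_norm {d : ℕ} (j : Fin d) : eNorm (basisV j) = Real.sqrt d := by
  have : ∀ i, (basisV j i) ^ 2 = if i = j then (d : ℝ) else 0 := by
    intro i; unfold basisV
    by_cases h : i = j
    · subst h; simp
    · simp [h]
  simp [eNorm, this]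

theorem dotp_basisV {d : ℕ} (v : Fin d → ℝ) (j : Fin d) : dotp v (basisV j) = v j * Real.sqrt d := by
  unfold dotp basisV
  rw [Finset.sum_eq_single j]
  · simp
  · intro b _ hb; simp [hb]
  · simp

theorem frob {p d : ℕ} (hd : 0 < d) (V : Fin p → Fin d → ℝ)
    (h : ∀ j : Fin d, Ssum (fun z => z) (fun z => z) V (basisV j) (basisV j) ≤ 2 * p) :
    ∑ k, eNorm (V k) ^ 2 ≤ 2 * p := by
  have hd' : (0 : ℝ) < d := by exact_mod_cast hd
  have e : d * ∑ k, eNorm (V k) ^ 2 = ∑ j : Fin d, Ssum (fun z => z) (fun z => z) V (basisV j) (basisV j) := by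
    unfold Ssum
    rw [Finset.sum_comm, Finset.mul_sum]
    refine Finset.sum_congr rfl fun k _ => ?_
    rw [← dotp_self, dotp, Finset.mul_sum]
    refine Finset.sum_congr rfl fun j _ => ?_
    rw [dotp_basisV]
    have := Real.mul_self_sqrt hd'.le
    linear_combination (-(V k j) ^ 2) * this
  have h2 : ∑ j : Fin d, Ssum (fun z => z) (fun z => z) V (basisV j) (basisV j) ≤ d * (2 * p) := by
    refine (Finset.sum_le_sum fun j _ => h j).trans ?_
    simp
  rw [← e] at h2
  exact le_of_mul_le_mul_left h2 hd'

theorem lip_ext {p d : ℕ} (hd : 0 < d) (V : Fin p → Fin d → ℝ) (hV : ∑ k, eNorm (V k) ^ 2 ≤ 2 * p)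
    {α β : ℝ → ℝ} {A : ℝ} (hA : 0 ≤ A)
    (hα : ∀ z, |α z| ≤ A * (1 + |z|)) (hβ : ∀ z, |β z| ≤ A * (1 + |z|))
    (hαl : ∀ y z, |α y - α z| ≤ A * |y - z|) (hβl : ∀ y z, |β y - β z| ≤ A * |y - z|)
    (x y x' y' : Fin d → ℝ) (hx' : eNorm x' = Real.sqrt d)
    (hy : eNorm y = Real.sqrt d) (ε : ℝ)
    (hxx : eNorm (x - x') ≤ ε) (hyy : eNorm (y - y') ≤ ε) :
    |Ssum α β V x y - Ssum α β V x' y'| ≤ 7 * A ^ 2 * ε * Real.sqrt d * p := by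
  have hε : 0 ≤ ε := (eNorm_nonneg _).trans hxx
  have hs1 : 1 ≤ Real.sqrt d := by rw [Real.one_le_sqrt]; exact_mod_cast hd
  have hb : ∀ (γ : ℝ → ℝ), (∀ z, |γ z| ≤ A * (1 + |z|)) → ∀ (w : Fin d → ℝ), eNorm w = Real.sqrt d → ∀ k,
      |γ (dotp (V k) w)| ≤ A * (1 + eNorm (V k) * Real.sqrt d) := by
    intro γ hγ w hw k
    refine (hγ _).trans ?_
    have := dotp_cs (V k) w
    rw [hw] at this
    gcongr
  have hl : ∀ (γ : ℝ → ℝ), (∀ y z, |γ y - γ z| ≤ A * |y - z|) → ∀ (w w' : Fin d → ℝ), eNorm (w - w') ≤ ε → ∀ k,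
      |γ (dotp (V k) w) - γ (dotp (V k) w')| ≤ A * (eNorm (V k) * ε) := by
    intro γ hγ w w' hw k
    refine (hγ _ _).trans ?_
    rw [dotp_sub_right]
    have := dotp_cs (V k) (w - w')
    have h2 : eNorm (V k) * eNorm (w - w') ≤ eNorm (V k) * ε := by
      gcongr; exact eNorm_nonneg _
    gcongr; linarith
  unfold Ssum
  rw [← Finset.sum_sub_distrib]
  refine (Finset.abs_sum_le_sum_abs _ _).trans ?_
  have hterm : ∀ k, |α (dotp (V k) x) * β (dotp (V k) y) - α (dotp (V k) x') * β (dotp (V k) y')| ≤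
      A ^ 2 * ε * Real.sqrt d * (1 + 3 * eNorm (V k) ^ 2) := by
    intro k
    have hn := eNorm_nonneg (V k)
    set v := eNorm (V k)
    have e : α (dotp (V k) x) * β (dotp (V k) y) - α (dotp (V k) x') * β (dotp (V k) y') =
      (α (dotp (V k) x) - α (dotp (V k) x')) * β (dotp (V k) y) +
       α (dotp (V k) x') * (β (dotp (V k) y) - β (dotp (V k) y')) := by ring
    rw [e]
    refine (abs_add_le _ _).trans ?_
    rw [abs_mul, abs_mul]
    have m1 := mul_le_mul (hl α hαl x x' hxx k) (hb β hβ y hy k) (abs_nonneg _) (by positivity)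
    have m2 := mul_le_mul (hb α hα x' hx' k) (hl β hβl y y' hyy k) (abs_nonneg _) (by positivity)
    refine (add_le_add m1 m2).trans ?_
    have h3 : 2 * v + 2 * v ^ 2 * Real.sqrt d ≤ Real.sqrt d * (1 + 3 * v ^ 2) := by
      nlinarith [mul_nonneg (sub_nonneg.mpr hs1) (sq_nonneg v), sq_nonneg (1 - v), mul_nonneg (sub_nonneg.mpr hs1) (sq_nonneg v), mul_nonneg (sub_nonneg.mpr hs1) (sq_nonneg (1 - v))]
    calc _ = A ^ 2 * ε * (2 * v + 2 * v ^ 2 * Real.sqrt d) := by ring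
      _ ≤ A ^ 2 * ε * (Real.sqrt d * (1 + 3 * v ^ 2)) := by gcongr
      _ = _ := by ring
  refine (Finset.sum_le_sum fun k _ => hterm k).trans ?_
  rw [← Finset.mul_sum, Finset.sum_add_distrib, ← Finset.mul_sum]
  simp only [Finset.sum_const, Finset.card_univ, Fintype.card_fin, nsmul_eq_mul, mul_one]
  calc A ^ 2 * ε * Real.sqrt d * ((p : ℝ) + 3 * ∑ k, eNorm (V k) ^ 2) ≤
      A ^ 2 * ε * Real.sqrt d * (p + 3 * (2 * p)) := by gcongr
    _ = _ := by ring

theorem sum_abs_le {n : ℕ} (a : Fin n → ℝ) : ∑ i, |a i| ≤ Real.sqrt n * eNorm a := by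
  have h := dotp_cs (fun i => |a i|) (fun _ => (1 : ℝ))
  have e1 : dotp (fun i => |a i|) (fun _ => (1 : ℝ)) = ∑ i, |a i| := by simp [dotp]
  have e2 : eNorm (fun _ : Fin n => (1 : ℝ)) = Real.sqrt n := by simp [eNorm]
  have e3 : eNorm (fun i => |a i|) = eNorm a := by simp [eNorm]
  rw [e1, e2, e3] at h
  rw [mul_comm]; exact (le_abs_self _).trans h

theorem lin_bound {n : ℕ} (a b : Fin n → ℝ) (η : ℝ) (h : ∀ i, |b i| ≤ η) (hη : 0 ≤ η) :
    |∑ i, a i * b i| ≤ η * (Real.sqrt n * eNorm a) := by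
  refine (Finset.abs_sum_le_sum_abs _ _).trans ?_
  calc ∑ i, |a i * b i| ≤ ∑ i, η * |a i| := Finset.sum_le_sum fun i _ => by
        rw [abs_mul, mul_comm]; exact mul_le_mul_of_nonneg_right (h i) (abs_nonneg _)
    _ = η * ∑ i, |a i| := by rw [Finset.mul_sum]
    _ ≤ _ := mul_le_mul_of_nonneg_left (sum_abs_le a) hη

theorem bil_bound {n : ℕ} (a : Fin n → ℝ) (B : Fin n → Fin n → ℝ) (τ : ℝ) (hτ : 0 ≤ τ) (h : ∀ i j, |B i j| ≤ τ) :
    |∑ i, a i * ∑ j, a j * B i j| ≤ n * τ * eNorm a ^ 2 := by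
  have h1 := lin_bound a (fun i => ∑ j, a j * B i j) (τ * (Real.sqrt n * eNorm a))
    (fun i => lin_bound a (B i) τ (h i) hτ) (by have := eNorm_nonneg a; positivity)
  refine h1.trans (le_of_eq ?_)
  have := Real.mul_self_sqrt (Nat.cast_nonneg (α := ℝ) n)
  linear_combination τ * eNorm a ^ 2 * this

set_option maxHeartbeats 1000000 in
theorem determ {p d n : ℕ} (hp : 0 < p) (φ : ℝ → ℝ) (V : Fin p → Fin d → ℝ) (X : Fin n → Fin d → ℝ)
    (hX : ∀ i, eNorm (X i) = Real.sqrt d) (xh : Fin d → ℝ) (hxh : eNorm xh = Real.sqrt d)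
    (a : Fin n → ℝ) (ha : featureMap φ V xh = fun k => ∑ i, a i * featureMap φ V (X i) k)
    (m δ η τ : ℝ) (hη : 0 ≤ η) (hτ : 0 ≤ τ) (hηδ : η ≤ δ) (hηn : η * Real.sqrt n ≤ δ) (hτn : n * τ ≤ δ)
    (H1 : |Ssum (psiF φ) (psiF φ) V xh xh / p - m| ≤ δ)
    (H2 : ∀ x y, eNorm x = Real.sqrt d → eNorm y = Real.sqrt d → |Ssum (fun z => z) (psiF φ) V y x / p| ≤ η)
    (H3 : ∀ i j, |Ssum (fun z => z) (psiF φ) V (X i) (X j) / p| ≤ τ)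
    (H4 : ∀ i j, |Ssum (psiF φ) (psiF φ) V (X i) (X j) / p - if i = j then m else 0| ≤ τ) :
    |m - m * eNorm a ^ 2| ≤ δ * (1 + eNorm a ^ 2) * (1 + 2 * |hermiteCoeff φ 1|) := by
  set μ := hermiteCoeff φ 1 with hμ
  set ψ := psiF φ with hψ
  have hp' : (0 : ℝ) < p := by exact_mod_cast hp
  set P : Fin p → ℝ := fun k => ψ (dotp (V k) xh) with hP
  set l : Fin p → ℝ := fun k => dotp (V k) xh with hl
  set Q : Fin p → ℝ := fun k => ∑ i, a i * ψ (dotp (V k) (X i)) with hQ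
  set q : Fin p → ℝ := fun k => ∑ i, a i * dotp (V k) (X i) with hq
  have hrel : ∀ k, P k - Q k = -μ * (l k - q k) := by
    intro k
    have h := congrFun ha k
    simp only [featureMap] at h
    have e1 : P k = φ (dotp (V k) xh) - μ * l k := rfl
    have e2 : Q k = ∑ i, a i * φ (dotp (V k) (X i)) - μ * q k := by
      simp only [hQ, hq, hψ, psiF, mul_sub, Finset.sum_sub_distrib, Finset.mul_sum]
      congr 1
      exact Finset.sum_congr rfl fun i _ => by ring
    rw [e1, e2, h]; ring
  -- sums
  have sPP : (∑ k, P k * P k) / p = Ssum ψ ψ V xh xh / p := rfl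
  have slP : (∑ k, l k * P k) / p = Ssum (fun z => z) ψ V xh xh / p := rfl
  have slQ : (∑ k, l k * Q k) / p = ∑ i, a i * (Ssum (fun z => z) ψ V xh (X i) / p) := by
    simp only [hQ, Ssum, Finset.mul_sum, Finset.sum_div, hl]
    rw [Finset.sum_comm]
    exact Finset.sum_congr rfl fun i _ => Finset.sum_congr rfl fun k _ => by ring
  have sqP : (∑ k, q k * P k) / p = ∑ i, a i * (Ssum (fun z => z) ψ V (X i) xh / p) := by
    simp only [hq, hP, Ssum, Finset.mul_sum, Finset.sum_mul, Finset.sum_div]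
    rw [Finset.sum_comm]
    exact Finset.sum_congr rfl fun i _ => Finset.sum_congr rfl fun k _ => by ring
  have sgen : ∀ α β : ℝ → ℝ, (∑ k, (∑ i, a i * α (dotp (V k) (X i))) * (∑ j, a j * β (dotp (V k) (X j)))) / p =
      ∑ i, a i * ∑ j, a j * (Ssum α β V (X i) (X j) / p) := by
    intro α β
    simp only [Ssum, Finset.mul_sum, Finset.sum_mul, Finset.sum_div]
    rw [Finset.sum_comm]
    rw [Finset.sum_congr rfl fun j _ => Finset.sum_comm, Finset.sum_comm]
    exact Finset.sum_congr rfl fun i _ => Finset.sum_congr rfl fun j _ => Finset.sum_congr rfl fun k _ => by ring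
  have sqQ : (∑ k, q k * Q k) / p = ∑ i, a i * ∑ j, a j * (Ssum (fun z => z) ψ V (X i) (X j) / p) :=
    sgen (fun z => z) ψ
  have sQQ : (∑ k, Q k * Q k) / p = ∑ i, a i * ∑ j, a j * (Ssum ψ ψ V (X i) (X j) / p) := sgen ψ ψ
  set N := eNorm a with hN
  have hN0 : 0 ≤ N := eNorm_nonneg a
  have b1 : |(∑ k, l k * P k) / p| ≤ η := by rw [slP]; exact H2 _ _ hxh hxh
  have b2 : |(∑ k, l k * Q k) / p| ≤ η * (Real.sqrt n * N) := by
    rw [slQ]; exact lin_bound a _ η (fun i => H2 _ _ (hX i) hxh) hη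
  have b3 : |(∑ k, q k * P k) / p| ≤ η * (Real.sqrt n * N) := by
    rw [sqP]; exact lin_bound a _ η (fun i => H2 _ _ hxh (hX i)) hη
  have b4 : |(∑ k, q k * Q k) / p| ≤ n * τ * N ^ 2 := by
    rw [sqQ]; exact bil_bound a _ τ hτ H3
  have b5 : |(∑ k, Q k * Q k) / p - m * N ^ 2| ≤ n * τ * N ^ 2 := by
    have e : m * N ^ 2 = ∑ i, a i * ∑ j, a j * (if i = j then m else 0) := by
      rw [hN, ← dotp_self, dotp, Finset.mul_sum]
      refine Finset.sum_congr rfl fun i _ => ?_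
      simp; ring
    rw [sQQ, e, ← Finset.sum_sub_distrib]
    have := bil_bound a (fun i j => Ssum ψ ψ V (X i) (X j) / p - if i = j then m else 0) τ hτ H4
    convert this using 3 with i
    rw [← mul_sub, ← Finset.sum_sub_distrib]
    congr 1
    exact Finset.sum_congr rfl fun j _ => by ring
  have hdiff : (∑ k, P k * P k) / p - (∑ k, Q k * Q k) / p =
      -μ * ((∑ k, l k * P k) / p + (∑ k, l k * Q k) / p - (∑ k, q k * P k) / p - (∑ k, q k * Q k) / p) := by
    have : ∑ k, P k * P k - ∑ k, Q k * Q k =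
      -μ * (∑ k, l k * P k + ∑ k, l k * Q k - ∑ k, q k * P k - ∑ k, q k * Q k) := by
      rw [← Finset.sum_sub_distrib, ← Finset.sum_add_distrib, ← Finset.sum_sub_distrib, ← Finset.sum_sub_distrib,
        Finset.mul_sum]
      refine Finset.sum_congr rfl fun k _ => ?_
      linear_combination (P k + Q k) * hrel k
    rw [← sub_div, this]; ring
  have c1 : η * (Real.sqrt n * N) ≤ δ * N := by
    rw [← mul_assoc]; exact mul_le_mul_of_nonneg_right hηn hN0
  have c2 : n * τ * N ^ 2 ≤ δ * N ^ 2 := by gcongr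
  have hδ : 0 ≤ δ := hη.trans hηδ
  have c3 : 2 * (δ * N) ≤ δ * (1 + N ^ 2) := by nlinarith [mul_nonneg hδ (sq_nonneg (1 - N))]
  have hbr : |(∑ k, l k * P k) / p + (∑ k, l k * Q k) / p - (∑ k, q k * P k) / p - (∑ k, q k * Q k) / p| ≤
      2 * δ * (1 + N ^ 2) := by
    rw [abs_le] at b1 b2 b3 b4 ⊢
    constructor <;> linarith
  have hd2 : |(∑ k, P k * P k) / p - (∑ k, Q k * Q k) / p| ≤ |μ| * (2 * δ * (1 + N ^ 2)) := by
    rw [hdiff, abs_mul, abs_neg]; gcongr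
  rw [← sPP] at H1
  rw [abs_le] at H1 b5 hd2 ⊢
  constructor <;> linarith

theorem determ_concl {m κ δ A : ℝ} (hm : 0 < m) (hA : 0 ≤ A) (hδ : κ * δ ≤ m / 2)
    (h : |m - m * A| ≤ δ * (1 + A) * κ) (hδ0 : 0 ≤ δ) (hκ : 0 ≤ κ) : |A - 1| ≤ (4 * κ / m) * δ := by
  have e : |m - m * A| = m * |A - 1| := by
    rw [show m - m * A = -(m * (A - 1)) by ring, abs_neg, abs_mul, abs_of_pos hm]
  rw [e] at h
  have h1 : 1 + A ≤ 2 + |A - 1| := by have := le_abs_self (A - 1); linarith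
  have h2 : δ * (1 + A) * κ ≤ (κ * δ) * (2 + |A - 1|) := by
    calc δ * (1 + A) * κ = (κ * δ) * (1 + A) := by ring
      _ ≤ _ := by gcongr
  have h3 : (κ * δ) * |A - 1| ≤ m / 2 * |A - 1| := by gcongr
  rw [div_mul_eq_mul_div, le_div_iff₀ hm]
  nlinarith

theorem measurable_eNorm {d : ℕ} : Measurable (fun x : Fin d → ℝ => eNorm x) := by
  unfold eNorm; fun_prop

theorem prod_slice_le {Ω Ω' : Type*} [MeasurableSpace Ω] [MeasurableSpace Ω'] (μ : Measure Ω) (ν : Measure Ω')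
    [IsProbabilityMeasure μ] [IsProbabilityMeasure ν] {s : Set (Ω × Ω')} (hs : MeasurableSet s) (ε : ENNReal)
    (h : ∀ y, μ {x | (x, y) ∈ s} ≤ ε) : (μ.prod ν) s ≤ ε := by
  rw [Measure.prod_apply_symm hs]
  calc ∫⁻ y, μ ((fun x => (x, y)) ⁻¹' s) ∂ν ≤ ∫⁻ _, ε ∂ν := lintegral_mono fun y => h y
    _ = ε := by simp

theorem data_tail {d : ℕ} (hd : 0 < d) {P : Measure (Fin d → ℝ)} {K : ℝ} (hP : DataAssumption P K)
    (u : Fin d → ℝ) (hu : eNorm u = 1) (s : ℝ) (hs : 0 ≤ s) :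
    P {x | s ≤ |dotp x u|} ≤ ENNReal.ofReal (2 * Real.exp (-(s ^ 2 / (K + 1) ^ 2))) ∧ 0 < K + 1 := by
  have := hP.prob
  have hd' : (0 : ℝ) < d := by exact_mod_cast hd
  have hbnd : ∀ w : Fin d → ℝ, eNorm w = 1 → ∀ t : ℝ, ∀ᵐ x ∂P,
      Real.exp ((dotp w x) ^ 2 / t ^ 2) ≤ Real.exp (d / t ^ 2) := by
    intro w hw t
    filter_upwards [hP.norm_eq] with x hx
    have h1 := dotp_cs w x
    rw [hw, hx, one_mul] at h1
    have h2 : (dotp w x) ^ 2 ≤ d := by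
      rw [← sq_abs, ← Real.sq_sqrt hd'.le]; exact pow_le_pow_left₀ (abs_nonneg _) h1 2
    gcongr
  have hm : ∀ w : Fin d → ℝ, ∀ t : ℝ, Measurable (fun x => Real.exp ((dotp w x) ^ 2 / t ^ 2)) := by
    intro w t
    exact (((measurable_dotp measurable_const measurable_id).pow_const 2).div_const _).exp
  have hIntg : ∀ w : Fin d → ℝ, eNorm w = 1 → ∀ t : ℝ, Integrable (fun x => Real.exp ((dotp w x) ^ 2 / t ^ 2)) P := by
    intro w hw t
    refine (integrable_const (Real.exp (d / t ^ 2))).mono' (hm w t).aestronglyMeasurable ?_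
    filter_upwards [hbnd w hw t] with x hx
    rwa [Real.norm_eq_abs, abs_of_pos (Real.exp_pos _)]
  have hl2 : 0 < Real.log 2 := Real.log_pos (by norm_num)
  set t0 := Real.sqrt (d / Real.log 2) with ht0
  have ht0p : 0 < t0 := Real.sqrt_pos.mpr (by positivity)
  have hmem : ∀ w : Fin d → ℝ, eNorm w = 1 → t0 ∈ {t : ℝ | 0 < t ∧ ∫ x, Real.exp ((dotp w x) ^ 2 / t ^ 2) ∂P ≤ 2} := by
    intro w hw
    refine ⟨ht0p, ?_⟩
    have h1 := integral_mono_ae (hIntg w hw t0) (integrable_const (Real.exp (d / t0 ^ 2))) (hbnd w hw t0)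
    refine h1.trans ?_
    rw [ht0, Real.sq_sqrt (by positivity)]
    have : (d : ℝ) / (d / Real.log 2) = Real.log 2 := by field_simp
    rw [this, Real.exp_log (by norm_num)]; simp
  have hbb : ∀ w : Fin d → ℝ, BddBelow {t : ℝ | 0 < t ∧ ∫ x, Real.exp ((dotp w x) ^ 2 / t ^ 2) ∂P ≤ 2} :=
    fun w => ⟨0, fun t ht => ht.1.le⟩
  have hba : BddAbove (Set.range fun u : {u : Fin d → ℝ // eNorm u = 1} =>
      sInf {t : ℝ | 0 < t ∧ ∫ x, Real.exp ((dotp u.1 x) ^ 2 / t ^ 2) ∂P ≤ 2}) := by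
    refine ⟨t0, ?_⟩
    rintro _ ⟨w, rfl⟩
    exact csInf_le (hbb _) (hmem _ w.2)
  have h1 := (le_ciSup hba ⟨u, hu⟩).trans hP.subg
  obtain ⟨t, ⟨htp, ht2⟩, htK⟩ := exists_lt_of_csInf_lt ⟨t0, hmem u hu⟩ (lt_of_le_of_lt h1 (lt_add_one K))
  have hK : 0 < K + 1 := htp.trans htK
  refine ⟨?_, hK⟩
  have hmk := mul_meas_ge_le_integral_of_nonneg (μ := P) (f := fun x => Real.exp ((dotp u x) ^ 2 / t ^ 2))
    (Eventually.of_forall fun x => (Real.exp_pos _).le) (hIntg u hu t) (Real.exp (s ^ 2 / t ^ 2))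
  have hsub : {x | s ≤ |dotp x u|} ⊆ {x | Real.exp (s ^ 2 / t ^ 2) ≤ Real.exp ((dotp u x) ^ 2 / t ^ 2)} := by
    intro x hx
    simp only [Set.mem_ofPred_eq] at hx ⊢
    rw [dotp_comm] at hx
    have : s ^ 2 ≤ (dotp u x) ^ 2 := by rw [← sq_abs (dotp u x)]; exact pow_le_pow_left₀ hs hx 2
    gcongr
  refine (measure_mono hsub).trans ?_
  rw [← ofReal_measureReal]
  apply ENNReal.ofReal_le_ofReal
  have h3 : Real.exp (-(s ^ 2 / t ^ 2)) ≤ Real.exp (-(s ^ 2 / (K + 1) ^ 2)) := by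
    gcongr
  have h4 : P.real {x | Real.exp (s ^ 2 / t ^ 2) ≤ Real.exp ((dotp u x) ^ 2 / t ^ 2)} ≤ 2 * Real.exp (-(s ^ 2 / t ^ 2)) := by
    rw [Real.exp_neg, ← div_eq_mul_inv, le_div_iff₀ (Real.exp_pos _), mul_comm]
    exact hmk.trans ht2
  linarith

theorem pair_law {d n : ℕ} (P : Measure (Fin d → ℝ)) [IsProbabilityMeasure P] (i j : Fin n) (hij : i ≠ j) :
    (Measure.pi fun _ : Fin n => P).map (fun X => (X i, X j)) = P.prod P := by
  have h : iIndepFun (fun (i : Fin n) (X : Fin n → Fin d → ℝ) => X i) (Measure.pi fun _ : Fin n => P) :=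
    iIndepFun_pi (X := fun _ (z : Fin d → ℝ) => z) (fun _ => aemeasurable_id)
  have h2 := h.indepFun hij
  rw [h2.map_prod_eq_prod_map_map (measurable_pi_apply i).aemeasurable (measurable_pi_apply j).aemeasurable]
  rw [(measurePreserving_eval (fun _ : Fin n => P) i).map_eq, (measurePreserving_eval (fun _ : Fin n => P) j).map_eq]

theorem pair_tail {d n : ℕ} (hd : 0 < d) {P : Measure (Fin d → ℝ)} {K : ℝ} (hP : DataAssumption P K)
    (s : ℝ) (hs : 0 ≤ s) (i j : Fin n) (hij : i ≠ j) :
    (Measure.pi fun _ : Fin n => P) {X | eNorm (X j) = Real.sqrt d ∧ s * Real.sqrt d ≤ |dotp (X i) (X j)|} ≤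
      ENNReal.ofReal (2 * Real.exp (-(s ^ 2 / (K + 1) ^ 2))) := by
  have := hP.prob
  have hd' : (0 : ℝ) < d := by exact_mod_cast hd
  have hsd : 0 < Real.sqrt d := Real.sqrt_pos.mpr hd'
  set S : Set ((Fin d → ℝ) × (Fin d → ℝ)) := {z | eNorm z.2 = Real.sqrt d ∧ s * Real.sqrt d ≤ |dotp z.1 z.2|} with hS
  have hSm : MeasurableSet S := by
    refine (measurableSet_eq_fun (measurable_eNorm.comp measurable_snd) measurable_const).inter ?_
    exact measurableSet_le measurable_const (measurable_dotp measurable_fst measurable_snd).abs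
  have e : {X : Fin n → Fin d → ℝ | eNorm (X j) = Real.sqrt d ∧ s * Real.sqrt d ≤ |dotp (X i) (X j)|} =
    (fun X : Fin n → Fin d → ℝ => (X i, X j)) ⁻¹' S := rfl
  rw [e, ← Measure.map_apply ((measurable_pi_apply i).prodMk (measurable_pi_apply j)) hSm, pair_law P i j hij]
  refine prod_slice_le _ _ hSm _ fun y => ?_
  by_cases hy : eNorm y = Real.sqrt d
  · set u : Fin d → ℝ := (Real.sqrt d)⁻¹ • y with hu
    have hun : eNorm u = 1 := by
      have h1 := dotp_self u
      have h2 : dotp u u = 1 := by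
        rw [hu, dotp_smul_right, dotp_comm, dotp_smul_right, dotp_self_sphere y hy]
        have := Real.mul_self_sqrt hd'.le
        field_simp; nlinarith
      rw [h2] at h1
      have := eNorm_nonneg u
      nlinarith
    refine (measure_mono ?_).trans (data_tail hd hP u hun s hs).1
    intro x hx
    have := hx.2
    simp only [Set.mem_ofPred_eq] at this ⊢
    rw [hu, dotp_smul_right, abs_mul, abs_of_pos (inv_pos.mpr hsd), inv_mul_eq_div, le_div_iff₀ hsd]
    exact this
  · have : {x | (x, y) ∈ S} = ∅ := by
      ext x; simp [hS, hy]
    rw [this]; simp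

def GoodData {d n : ℕ} (s : ℝ) (X : Fin n → Fin d → ℝ) : Prop :=
  (∀ i, eNorm (X i) = Real.sqrt d) ∧ ∀ i j, i ≠ j → |dotp (X i) (X j)| ≤ s * Real.sqrt d

theorem measurable_goodData {d n : ℕ} (s : ℝ) : MeasurableSet {X : Fin n → Fin d → ℝ | GoodData s X} := by
  have : {X : Fin n → Fin d → ℝ | GoodData s X} = (⋂ i, {X | eNorm (X i) = Real.sqrt d}) ∩
      ⋂ i, ⋂ j, ⋂ (_ : i ≠ j), {X | |dotp (X i) (X j)| ≤ s * Real.sqrt d} := by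
    ext X; simp [GoodData]
  rw [this]
  refine (MeasurableSet.iInter fun i => ?_).inter
    (MeasurableSet.iInter fun i => MeasurableSet.iInter fun j => MeasurableSet.iInter fun _ => ?_)
  · exact measurableSet_eq_fun (measurable_eNorm.comp (measurable_pi_apply i)) measurable_const
  · exact measurableSet_le (measurable_dotp (measurable_pi_apply i) (measurable_pi_apply j)).abs measurable_const

theorem goodData_prob {d n : ℕ} (hd : 0 < d) {P : Measure (Fin d → ℝ)} {K : ℝ} (hP : DataAssumption P K)
    (s : ℝ) (hs : 0 ≤ s) :
    (Measure.pi fun _ : Fin n => P) {X | ¬ GoodData s X} ≤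
      ENNReal.ofReal ((n : ℝ) ^ 2 * (2 * Real.exp (-(s ^ 2 / (K + 1) ^ 2)))) := by
  have := hP.prob
  set ν := (Measure.pi fun _ : Fin n => P)
  set B : Fin n × Fin n → Set (Fin n → Fin d → ℝ) := fun q =>
    if q.1 = q.2 then ∅ else {X | eNorm (X q.2) = Real.sqrt d ∧ s * Real.sqrt d ≤ |dotp (X q.1) (X q.2)|} with hB
  have hnull : ν {X | ¬ ∀ i, eNorm (X i) = Real.sqrt d} = 0 := by
    have : ∀ᵐ X ∂ν, ∀ i, eNorm (X i) = Real.sqrt d := by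
      rw [ae_all_iff]
      intro i
      exact (measurePreserving_eval (fun _ : Fin n => P) i).quasiMeasurePreserving.ae hP.norm_eq
    exact this
  have hsub : {X : Fin n → Fin d → ℝ | ¬ GoodData s X} ⊆ {X | ¬ ∀ i, eNorm (X i) = Real.sqrt d} ∪ ⋃ q ∈ (Finset.univ : Finset (Fin n × Fin n)), B q := by
    intro X hX
    by_cases h : ∀ i, eNorm (X i) = Real.sqrt d
    · right
      simp only [GoodData, Set.mem_ofPred_eq, not_and, not_forall] at hX
      obtain ⟨i, j, hij, hlt⟩ := hX h
      simp only [Finset.mem_univ, Set.iUnion_true, Set.mem_iUnion]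
      refine ⟨(i, j), ?_⟩
      simp only [hB, if_neg hij]
      exact ⟨h j, (not_le.mp hlt).le⟩
    · left; exact h
  refine (measure_mono hsub).trans ((measure_union_le _ _).trans ?_)
  rw [hnull, zero_add]
  refine (measure_biUnion_finset_le _ _).trans ?_
  have : ∀ q ∈ (Finset.univ : Finset (Fin n × Fin n)), ν (B q) ≤ ENNReal.ofReal (2 * Real.exp (-(s ^ 2 / (K + 1) ^ 2))) := by
    intro q _
    simp only [hB]
    split_ifs with h
    · simp
    · exact pair_tail hd hP s hs q.1 q.2 h
  refine (Finset.sum_le_sum this).trans ?_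
  rw [Finset.sum_const, nsmul_eq_mul, Finset.card_univ, Fintype.card_prod, Fintype.card_fin,
    ENNReal.ofReal_mul (p := (n : ℝ) ^ 2) (by positivity)]
  apply le_of_eq; congr 1
  rw [ENNReal.ofReal_pow (Nat.cast_nonneg n), ENNReal.ofReal_natCast]; push_cast; ring

def SphereGood {p d : ℕ} (ψ : ℝ → ℝ) (m η : ℝ) (V : Fin p → Fin d → ℝ) : Prop :=
  (∀ x, eNorm x = Real.sqrt d → |Ssum ψ ψ V x x / p - m| ≤ η) ∧
  ∀ x y, eNorm x = Real.sqrt d → eNorm y = Real.sqrt d → |Ssum (fun z => z) ψ V y x / p| ≤ η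

def EntryGood {p d n : ℕ} (ψ : ℝ → ℝ) (m τ : ℝ) (V : Fin p → Fin d → ℝ) (X : Fin n → Fin d → ℝ) : Prop :=
  (∀ i j, |Ssum (fun z => z) ψ V (X i) (X j) / p| ≤ τ) ∧
  ∀ i j, |Ssum ψ ψ V (X i) (X j) / p - if i = j then m else 0| ≤ τ

theorem measurable_Ssum {p d n : ℕ} {α β : ℝ → ℝ} (hα : Measurable α) (hβ : Measurable β) (i j : Fin n) :
    Measurable (fun ω : (Fin p → Fin d → ℝ) × (Fin n → Fin d → ℝ) => Ssum α β ω.1 (ω.2 i) (ω.2 j)) := by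
  unfold Ssum
  refine Finset.measurable_sum _ fun k _ => ?_
  have h1 : Measurable (fun ω : (Fin p → Fin d → ℝ) × (Fin n → Fin d → ℝ) => ω.1 k) :=
    (measurable_pi_apply k).comp measurable_fst
  have h2 : ∀ i, Measurable (fun ω : (Fin p → Fin d → ℝ) × (Fin n → Fin d → ℝ) => ω.2 i) := fun i =>
    (measurable_pi_apply i).comp measurable_snd
  exact (hα.comp (measurable_dotp h1 (h2 i))).mul (hβ.comp (measurable_dotp h1 (h2 j)))

theorem measurable_entryGood {p d n : ℕ} {ψ : ℝ → ℝ} (hψ : Measurable ψ) (m τ : ℝ) :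
    MeasurableSet {ω : (Fin p → Fin d → ℝ) × (Fin n → Fin d → ℝ) | EntryGood ψ m τ ω.1 ω.2} := by
  have : {ω : (Fin p → Fin d → ℝ) × (Fin n → Fin d → ℝ) | EntryGood ψ m τ ω.1 ω.2} =
      (⋂ i, ⋂ j, {ω | |Ssum (fun z => z) ψ ω.1 (ω.2 i) (ω.2 j) / p| ≤ τ}) ∩
      ⋂ i, ⋂ j, {ω | |Ssum ψ ψ ω.1 (ω.2 i) (ω.2 j) / p - if i = j then m else 0| ≤ τ} := by
    ext X; simp [EntryGood]
  rw [this]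
  refine (MeasurableSet.iInter fun i => MeasurableSet.iInter fun j => ?_).inter
    (MeasurableSet.iInter fun i => MeasurableSet.iInter fun j => ?_)
  · exact measurableSet_le ((measurable_Ssum measurable_id' hψ i j).div_const _).abs measurable_const
  · exact measurableSet_le (((measurable_Ssum hψ hψ i j).div_const _).sub_const _).abs measurable_const

/-- Tail bound hypothesis produced by `bernstein_rf`. -/
def Tail (A c t₀ : ℝ) : Prop := ∀ α β : ℝ → ℝ, Measurable α → Measurable β →
    (∀ z, |α z| ≤ A * (1 + |z|)) → (∀ z, |β z| ≤ A * (1 + |z|)) →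
    ∀ (d p : ℕ), 0 < d → 0 < p → ∀ x y : Fin d → ℝ, eNorm x = Real.sqrt d → eNorm y = Real.sqrt d →
    ∀ t, 0 ≤ t → t ≤ t₀ →
    gaussianMatrix p d {V | t ≤ |Ssum α β V x y / p - Emean d α β x y|} ≤
      ENNReal.ofReal (2 * Real.exp (-(c * (p * t ^ 2))))

theorem id_bound {A : ℝ} (hA : 1 ≤ A) (z : ℝ) : |z| ≤ A * (1 + |z|) := by
  have := abs_nonneg z; nlinarith

theorem sphere_event {ψ : ℝ → ℝ} {A c t₀ : ℝ} (hA : 1 ≤ A) (hψ : GoodPsi ψ A)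
    (hl : ∀ y z, |ψ y - ψ z| ≤ A * |y - z|) (hT : Tail A c t₀) {d p : ℕ} (hd : 3 ≤ d) (hp : 0 < p)
    (t : ℝ) (ht : 0 ≤ t) (htt : t ≤ t₀) (ht1 : t ≤ 1) :
    gaussianMatrix p d {V | ¬ SphereGood ψ (∫ z, ψ z * ψ z ∂(gaussianReal 0 1)) (t + 7 * A ^ 2 / d) V} ≤
      ENNReal.ofReal (3 * ((d : ℝ) ^ (5 * d)) ^ 2 * (2 * Real.exp (-(c * (p * t ^ 2))))) := by
  classical
  set m := ∫ z, ψ z * ψ z ∂(gaussianReal 0 1) with hm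
  set B := 2 * Real.exp (-(c * (p * t ^ 2))) with hB
  have hB0 : 0 ≤ B := by positivity
  have hd0 : 0 < d := by omega
  have hd' : (0 : ℝ) < d := by exact_mod_cast hd0
  have hp' : (0 : ℝ) < p := by exact_mod_cast hp
  have hd3 : (3 : ℝ) ≤ d := by exact_mod_cast hd
  obtain ⟨N, hN, hNc, hNnet⟩ := net_exists d hd
  have u1 := union_rf N (p := p) ψ ψ id id t B (fun x hx => hT ψ ψ hψ.meas hψ.meas hψ.bound hψ.bound d p hd0 hp _ _ (hN x hx) (hN x hx) t ht htt)
  have u2 := union_rf (N ×ˢ N) (p := p) (fun z => z) ψ Prod.fst Prod.snd t B (fun x hx =>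
    hT _ ψ measurable_id' hψ.meas (id_bound hA) hψ.bound d p hd0 hp _ _ (hN _ (Finset.mem_product.mp hx).1) (hN _ (Finset.mem_product.mp hx).2) t ht htt)
  have u3 := union_rf (Finset.univ : Finset (Fin d)) (p := p) (fun z => z) (fun z => z) basisV basisV t B (fun x hx =>
    hT _ _ measurable_id' measurable_id' (id_bound hA) (id_bound hA) d p hd0 hp _ _ (basisV_norm x) (basisV_norm x) t ht htt)
  have hsub : {V : Fin p → Fin d → ℝ | ¬ SphereGood ψ m (t + 7 * A ^ 2 / d) V} ⊆
      ({V | ∃ i ∈ N, t ≤ |Ssum ψ ψ V (id i) (id i) / p - Emean d ψ ψ (id i) (id i)|} ∪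
      {V | ∃ i ∈ N ×ˢ N, t ≤ |Ssum (fun z => z) ψ V (Prod.fst i) (Prod.snd i) / p - Emean d (fun z => z) ψ (Prod.fst i) (Prod.snd i)|}) ∪
      {V | ∃ i ∈ (Finset.univ : Finset (Fin d)), t ≤ |Ssum (fun z => z) (fun z => z) V (basisV i) (basisV i) / p - Emean d (fun z => z) (fun z => z) (basisV i) (basisV i)|} := by
    intro V hV
    by_contra hcon
    apply hV
    simp only [Set.mem_union, Set.mem_ofPred_eq, not_or, not_exists, not_and, not_le, id] at hcon
    obtain ⟨⟨h1, h2⟩, h3⟩ := hcon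
    have hfrob : ∑ k, eNorm (V k) ^ 2 ≤ 2 * p := by
      refine frob hd0 V fun j => ?_
      have := h3 j (Finset.mem_univ j)
      rw [emean_id hd0 _ (basisV_norm j), abs_lt] at this
      have h4 := this.2
      have h5 : Ssum (fun z => z) (fun z => z) V (basisV j) (basisV j) / p ≤ 2 := by linarith
      rwa [div_le_iff₀ hp'] at h5
    have herr : ∀ S S' : ℝ, |S - S'| ≤ 7 * A ^ 2 * (1 / (d : ℝ) ^ 2) * Real.sqrt d * p → |S / p - S' / p| ≤ 7 * A ^ 2 / d := by
      intro S S' h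
      rw [← sub_div, abs_div, abs_of_pos hp', div_le_iff₀ hp']
      refine h.trans ?_
      gcongr
      have hsq : Real.sqrt d ≤ d := by
        rw [Real.sqrt_le_left (by linarith)]; nlinarith
      calc 7 * A ^ 2 * (1 / (d : ℝ) ^ 2) * Real.sqrt d ≤ 7 * A ^ 2 * (1 / (d : ℝ) ^ 2) * d := by gcongr
        _ = _ := by field_simp
    have hA0 : 0 ≤ A := by linarith
    have hidl : ∀ y z : ℝ, |y - z| ≤ A * |y - z| := fun y z => by
      have := abs_nonneg (y - z); nlinarith
    constructor
    · intro x hx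
      obtain ⟨x', hx', hxx⟩ := hNnet x hx
      have e := herr _ _ (lip_ext hd0 V hfrob hA0 hψ.bound hψ.bound hl hl x x x' x' (hN _ hx') hx _ hxx hxx)
      have e2 := h1 x' hx'
      rw [emean_diag hψ.meas hd0 x' (hN _ hx')] at e2
      rw [abs_le] at e ⊢
      rw [abs_lt] at e2
      constructor <;> linarith
    · intro x y hx hy
      obtain ⟨x', hx', hxx⟩ := hNnet x hx
      obtain ⟨y', hy', hyy⟩ := hNnet y hy
      have e := herr _ _ (lip_ext hd0 V hfrob hA0 (id_bound hA) hψ.bound hidl hl y x y' x' (hN _ hy') hx _ hyy hxx)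
      have e2 := h2 (y', x') (Finset.mem_product.mpr ⟨hy', hx'⟩)
      simp only at e2
      rw [emean_cross hψ hd0 x' y' (hN _ hx') (hN _ hy')] at e2
      rw [abs_le] at e ⊢
      rw [abs_lt] at e2
      constructor <;> linarith
  refine (measure_mono hsub).trans ((measure_union_le _ _).trans ((add_le_add ((measure_union_le _ _).trans (add_le_add u1 u2)) u3).trans ?_))
  rw [← ENNReal.ofReal_add (by positivity) (by positivity), ← ENNReal.ofReal_add (by positivity) (by positivity)]
  apply ENNReal.ofReal_le_ofReal
  have hM1 : (1 : ℝ) ≤ (d : ℝ) ^ (5 * d) := one_le_pow₀ (by linarith)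
  have hMd : (d : ℝ) ≤ (d : ℝ) ^ (5 * d) := le_self_pow₀ (by linarith) (by omega)
  set M := (d : ℝ) ^ (5 * d)
  rw [Finset.card_product, Finset.card_univ, Fintype.card_fin]
  push_cast
  have hN0 : (0 : ℝ) ≤ N.card := Nat.cast_nonneg _
  have : (N.card : ℝ) + N.card * N.card + d ≤ 3 * M ^ 2 := by nlinarith
  calc _ = ((N.card : ℝ) + N.card * N.card + d) * B := by ring
    _ ≤ _ := by gcongr

theorem entry_event {ψ : ℝ → ℝ} {A c t₀ : ℝ} (hA : 1 ≤ A) (hψ : GoodPsi ψ A)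
    (hT : Tail A c t₀) {d p n : ℕ} (hd : 0 < d) (hp : 0 < p) (ν : Measure (Fin n → Fin d → ℝ)) [IsProbabilityMeasure ν]
    (t : ℝ) (ht : 0 ≤ t) (htt : t ≤ t₀) (s : ℝ) (hs : 0 ≤ s) (hs8 : s / Real.sqrt d ≤ 1 / 8) :
    ((gaussianMatrix p d).prod ν) {ω | GoodData s ω.2 ∧
      ¬ EntryGood ψ (∫ z, ψ z * ψ z ∂(gaussianReal 0 1)) (t + (A ^ 2 * 5 * 64 ^ 4 * M4 ^ 2) * (s / Real.sqrt d) ^ 3) ω.1 ω.2} ≤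
      ENNReal.ofReal (2 * (n : ℝ) ^ 2 * (2 * Real.exp (-(c * (p * t ^ 2))))) := by
  set m := ∫ z, ψ z * ψ z ∂(gaussianReal 0 1) with hm
  set B := 2 * Real.exp (-(c * (p * t ^ 2))) with hB
  set C₃ := A ^ 2 * 5 * 64 ^ 4 * M4 ^ 2 with hC3
  have hC30 : 0 ≤ C₃ := by positivity
  have hB0 : 0 ≤ B := by positivity
  have hd' : (0 : ℝ) < d := by exact_mod_cast hd
  have hp' : (0 : ℝ) < p := by exact_mod_cast hp
  have hsd : 0 < Real.sqrt d := Real.sqrt_pos.mpr hd'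
  have hE0 : 0 ≤ C₃ * (s / Real.sqrt d) ^ 3 := by positivity
  have hms : MeasurableSet {ω : (Fin p → Fin d → ℝ) × (Fin n → Fin d → ℝ) | GoodData s ω.2 ∧
      ¬ EntryGood ψ m (t + C₃ * (s / Real.sqrt d) ^ 3) ω.1 ω.2} :=
    (measurable_snd (measurable_goodData s)).inter (measurable_entryGood hψ.meas m _).compl
  refine prod_slice_le _ _ hms _ fun X => ?_
  by_cases hX : GoodData s X
  swap
  · have : {V : Fin p → Fin d → ℝ | (V, X) ∈ {ω : (Fin p → Fin d → ℝ) × (Fin n → Fin d → ℝ) | GoodData s ω.2 ∧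
      ¬ EntryGood ψ m (t + C₃ * (s / Real.sqrt d) ^ 3) ω.1 ω.2}} = ∅ := by
      ext V; simp [hX]
    rw [this]; simp
  have u1 := union_rf (Finset.univ : Finset (Fin n × Fin n)) (p := p) ψ ψ (fun q => X q.1) (fun q => X q.2) t B
    (fun q _ => hT ψ ψ hψ.meas hψ.meas hψ.bound hψ.bound d p hd hp _ _ (hX.1 _) (hX.1 _) t ht htt)
  have u2 := union_rf (Finset.univ : Finset (Fin n × Fin n)) (p := p) (fun z => z) ψ (fun q => X q.1) (fun q => X q.2) t B
    (fun q _ => hT _ ψ measurable_id' hψ.meas (id_bound hA) hψ.bound d p hd hp _ _ (hX.1 _) (hX.1 _) t ht htt)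
  have hsub : {V : Fin p → Fin d → ℝ | (V, X) ∈ {ω : (Fin p → Fin d → ℝ) × (Fin n → Fin d → ℝ) | GoodData s ω.2 ∧
      ¬ EntryGood ψ m (t + C₃ * (s / Real.sqrt d) ^ 3) ω.1 ω.2}} ⊆
      {V | ∃ q ∈ (Finset.univ : Finset (Fin n × Fin n)), t ≤ |Ssum ψ ψ V (X q.1) (X q.2) / p - Emean d ψ ψ (X q.1) (X q.2)|} ∪
      {V | ∃ q ∈ (Finset.univ : Finset (Fin n × Fin n)), t ≤ |Ssum (fun z => z) ψ V (X q.1) (X q.2) / p - Emean d (fun z => z) ψ (X q.1) (X q.2)|} := by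
    intro V hV
    by_contra hcon
    apply hV.2
    simp only [Set.mem_union, Set.mem_ofPred_eq, not_or, not_exists, not_and, not_le] at hcon
    obtain ⟨h1, h2⟩ := hcon
    constructor
    · intro i j
      have e2 := h2 (i, j) (Finset.mem_univ _)
      simp only at e2
      rw [emean_cross hψ hd (X j) (X i) (hX.1 _) (hX.1 _), sub_zero] at e2
      simp only
      linarith
    · intro i j
      have e2 := h1 (i, j) (Finset.mem_univ _)
      simp only at e2 ⊢
      split_ifs with hij
      · subst hij
        rw [emean_diag hψ.meas hd (X i) (hX.1 _)] at e2
        linarith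
      · have hρ : |dotp (X i) (X j) / d| ≤ s / Real.sqrt d := by
          have := hX.2 i j hij
          rw [abs_div, abs_of_pos hd', div_le_div_iff₀ hd' hsd]
          have hdd := Real.mul_self_sqrt hd'.le
          nlinarith [mul_le_mul_of_nonneg_right this hsd.le]
        have h3 := third_order hψ hd (X i) (X j) (hX.1 _) (hX.1 _) (hρ.trans hs8)
        have h4 : C₃ * |dotp (X i) (X j) / d| ^ 3 ≤ C₃ * (s / Real.sqrt d) ^ 3 := by gcongr
        have h5 : |Emean d ψ ψ (X i) (X j)| ≤ C₃ * (s / Real.sqrt d) ^ 3 := h3.trans h4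
        rw [sub_zero]
        rw [abs_lt] at e2
        rw [abs_le] at h5 ⊢
        constructor <;> linarith
  refine (measure_mono hsub).trans ((measure_union_le _ _).trans ((add_le_add u1 u2).trans ?_))
  rw [← ENNReal.ofReal_add (by positivity) (by positivity)]
  apply ENNReal.ofReal_le_ofReal
  rw [Finset.card_univ, Fintype.card_prod, Fintype.card_fin]
  push_cast
  apply le_of_eq; ring

theorem arith_scales {d n p L C₁ : ℝ} (hd : 1 ≤ d) (hn : 1 ≤ n) (hp : 0 < p) (hL : 1 ≤ L) (hC : 1 ≤ C₁)
    (hnd : n ≤ C₁ * d) :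
    Real.sqrt n * (Real.sqrt (d / p) * L) = Real.sqrt (d * n / p) * L ∧
    Real.sqrt (d / p) * L ≤ Real.sqrt (d * n / p) * L ∧
    L / Real.sqrt p ≤ Real.sqrt (d * n / p) * L ∧
    n * (L / Real.sqrt p) ≤ C₁ * (Real.sqrt (d * n / p) * L) ∧
    Real.sqrt n / d ≤ C₁ * (L ^ 3 / Real.sqrt d) ∧
    n * (L / Real.sqrt d) ^ 3 ≤ C₁ * (L ^ 3 / Real.sqrt d) ∧
    L / Real.sqrt d ≤ L ^ 3 / Real.sqrt d ∧
    p * (Real.sqrt (d / p) * L) ^ 2 = d * L ^ 2 ∧ p * (L / Real.sqrt p) ^ 2 = L ^ 2 := by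
  have hd0 : 0 ≤ d := by linarith
  have hn0 : 0 ≤ n := by linarith
  rw [Real.sqrt_div hd0, Real.sqrt_div (mul_nonneg hd0 hn0), Real.sqrt_mul hd0]
  have ea := Real.sq_sqrt hd0
  have eb := Real.sq_sqrt hn0
  have er := Real.sq_sqrt hp.le
  have ha : 1 ≤ Real.sqrt d := Real.one_le_sqrt.mpr hd
  have hb : 1 ≤ Real.sqrt n := Real.one_le_sqrt.mpr hn
  have hr : 0 < Real.sqrt p := Real.sqrt_pos.mpr hp
  set a := Real.sqrt d
  set b := Real.sqrt n
  set r := Real.sqrt p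
  have hnd2 : b ^ 2 ≤ C₁ * a ^ 2 := by rw [ea, eb]; exact hnd
  rw [← ea, ← eb, ← er]
  have ha0 : 0 < a := by linarith
  have hb0 : 0 < b := by linarith
  have hba : b ≤ C₁ * a := by
    apply (sq_le_sq₀ hb0.le (by positivity)).mp
    nlinarith [mul_nonneg (sub_nonneg.mpr hC) (sq_nonneg a), mul_nonneg (mul_nonneg (sub_nonneg.mpr hC) (sub_nonneg.mpr hC)) (sq_nonneg a)]
  have hL0 : 0 < L := by linarith
  have hC0 : 0 < C₁ := by linarith
  have hL3 : L ≤ L ^ 3 := le_self_pow₀ hL (by norm_num)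
  refine ⟨by ring, ?_, ?_, ?_, ?_, ?_, ?_, by field_simp, by field_simp⟩
  · gcongr; nlinarith
  · rw [div_mul_eq_mul_div]; gcongr
    nlinarith [mul_le_mul ha hb (by norm_num) ha0.le]
  · rw [← mul_div_assoc, div_mul_eq_mul_div, ← mul_div_assoc]
    refine div_le_div_of_nonneg_right ?_ hr.le
    nlinarith [mul_le_mul_of_nonneg_right hba (mul_pos hb0 hL0).le]
  · rw [← mul_div_assoc, div_le_div_iff₀ (by positivity) ha0]
    have : (1 : ℝ) ≤ L ^ 3 := hL.trans hL3
    calc b * a ≤ C₁ * a * a := by gcongr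
      _ = C₁ * 1 * a ^ 2 := by ring
      _ ≤ C₁ * L ^ 3 * a ^ 2 := by gcongr
  · rw [div_pow, ← mul_div_assoc, ← mul_div_assoc, div_le_div_iff₀ (by positivity) ha0]
    calc b ^ 2 * L ^ 3 * a ≤ (C₁ * a ^ 2) * L ^ 3 * a := by gcongr
      _ = _ := by ring
  · gcongr

theorem fail_bound {d n L C₁ c k b : ℝ} (hd : 1 ≤ d) (hdL : d = Real.exp L) (hn0 : 0 ≤ n) (hn : n ≤ C₁ * d) (hC : 1 ≤ C₁)
    (hb : 0 < b) (hbc : b ≤ c) (hbk : b ≤ k) (hL1 : 1 ≤ L) (hL2 : 20 / c ≤ L)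
    (hL3 : (4 / b) * (Real.log (6 * C₁ ^ 2) + 2) ≤ L) (D : ℕ) (hD : (D : ℝ) = d) :
    n ^ 2 * (2 * Real.exp (-(L ^ 2 * k))) + 3 * (d ^ (5 * D)) ^ 2 * (2 * Real.exp (-(c * (d * L ^ 2)))) +
      2 * n ^ 2 * (2 * Real.exp (-(c * L ^ 2))) ≤ 2 * Real.exp (-(b / 4) * L ^ 2) := by
  have hc : 0 < c := hb.trans_le hbc
  have hR : 0 ≤ Real.log (6 * C₁ ^ 2) := Real.log_nonneg (by nlinarith)
  have hRe : Real.exp (Real.log (6 * C₁ ^ 2)) = 6 * C₁ ^ 2 := Real.exp_log (by positivity)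
  set R := Real.log (6 * C₁ ^ 2)
  have hbL : R + 2 * L ≤ b / 4 * L ^ 2 := by
    have h1 : R + 2 ≤ b / 4 * L := by
      rw [div_mul_eq_mul_div, div_le_iff₀ hb] at hL3; linarith
    nlinarith [mul_le_mul_of_nonneg_right h1 (by linarith : 0 ≤ L), mul_nonneg hR (sub_nonneg.mpr hL1)]
  have hbLsq : 0 ≤ b * L ^ 2 := by positivity
  have hn2 : 6 * n ^ 2 ≤ Real.exp (R + 2 * L) := by
    rw [Real.exp_add, hRe, two_mul, Real.exp_add, ← hdL]
    nlinarith [pow_le_pow_left₀ hn0 hn 2]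
  have h1 : Real.exp (-(L ^ 2 * k)) ≤ Real.exp (-(b * L ^ 2)) := by
    apply Real.exp_le_exp.mpr; nlinarith [mul_le_mul_of_nonneg_right hbk (sq_nonneg L)]
  have h2 : Real.exp (-(c * L ^ 2)) ≤ Real.exp (-(b * L ^ 2)) := by
    apply Real.exp_le_exp.mpr; nlinarith [mul_le_mul_of_nonneg_right hbc (sq_nonneg L)]
  have h3 : n ^ 2 * (2 * Real.exp (-(L ^ 2 * k))) + 2 * n ^ 2 * (2 * Real.exp (-(c * L ^ 2))) ≤ Real.exp (-(b / 4) * L ^ 2) := by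
    calc _ ≤ n ^ 2 * (2 * Real.exp (-(b * L ^ 2))) + 2 * n ^ 2 * (2 * Real.exp (-(b * L ^ 2))) := by gcongr
      _ = (6 * n ^ 2) * Real.exp (-(b * L ^ 2)) := by ring
      _ ≤ Real.exp (R + 2 * L) * Real.exp (-(b * L ^ 2)) := by gcongr
      _ ≤ _ := by
        rw [← Real.exp_add]; apply Real.exp_le_exp.mpr; linarith
  have h4 : 3 * (d ^ (5 * D)) ^ 2 * (2 * Real.exp (-(c * (d * L ^ 2)))) ≤ Real.exp (-(b / 4) * L ^ 2) := by
    have e : (d ^ (5 * D)) ^ 2 = Real.exp (10 * d * L) := by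
      rw [← pow_mul, ← hD, hD, hdL, ← Real.exp_nat_mul, ← hdL, ← hD]; push_cast; ring_nf
    have h6 : (6 : ℝ) ≤ Real.exp R := by rw [hRe]; nlinarith
    have hcL : 20 ≤ c * L := by rw [div_le_iff₀ hc] at hL2; linarith
    calc 3 * (d ^ (5 * D)) ^ 2 * (2 * Real.exp (-(c * (d * L ^ 2)))) = 6 * (Real.exp (10 * d * L) * Real.exp (-(c * (d * L ^ 2)))) := by
          rw [e]; ring
      _ ≤ Real.exp R * (Real.exp (10 * d * L) * Real.exp (-(c * (d * L ^ 2)))) := by gcongr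
      _ ≤ _ := by
        rw [← Real.exp_add, ← Real.exp_add]; apply Real.exp_le_exp.mpr
        have h7 : 20 * (d * L) ≤ c * L * (d * L) := mul_le_mul_of_nonneg_right hcL (by positivity)
        have h8 : c * L ^ 2 ≤ d * (c * L ^ 2) := le_mul_of_one_le_left (by positivity) hd
        have h9 : b * L ^ 2 ≤ c * L ^ 2 := by gcongr
        nlinarith
  linarith

set_option maxHeartbeats 4000000

/-- **Lemma A.3 (Near-unit norm of the coefficient vector).**
Under the random features setup and the data, activation, and scaling assumptions:
there are constants `c, C > 0` such that for all sufficiently large `d`, with probability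
at least `1 − 2 exp(−c log² d)` over `V` and the data, simultaneously for every `x̂` on the
sphere of radius `√d` and every `a` with `φ(x̂) = Σᵢ aᵢ φ(xᵢ)`:
`|‖a‖₂² − 1| ≤ C (√(dn/p) log d + log³ d / √d)`. -/
theorem coefficient_vector_near_unit_norm
    (φ : ℝ → ℝ) (hφ : ActivationAssumptionCore φ)
    (K C₀ : ℝ)
    (n p : ℕ → ℕ)
    (P : (d : ℕ) → Measure (Fin d → ℝ))
    (hdata : ∀ d, DataAssumption (P d) K)
    (hn : ∀ d : ℕ, (n d : ℝ) ≤ C₀ * d)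
    (hp : Tendsto (fun d : ℕ => (p d : ℝ) / ((n d : ℝ) * d * (Real.log d) ^ 2))
      atTop atTop) :
    ∃ c : ℝ, 0 < c ∧ ∃ C : ℝ, 0 < C ∧ ∃ D : ℕ, ∀ d : ℕ, D ≤ d →
      1 - ENNReal.ofReal (2 * Real.exp (-c * (Real.log d) ^ 2)) ≤
        ((gaussianMatrix (p d) d).prod (Measure.pi fun _ : Fin (n d) => P d))
          {ω | ∀ xh : Fin d → ℝ, eNorm xh = Real.sqrt d →
            ∀ a : Fin (n d) → ℝ,
              featureMap φ ω.1 xh =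
                (fun k => ∑ i, a i * featureMap φ ω.1 (ω.2 i) k) →
              |(eNorm a) ^ 2 - 1| ≤
                C * (Real.sqrt ((d : ℝ) * (n d) / (p d)) * Real.log d +
                  (Real.log d) ^ 3 / Real.sqrt d)} := by
  obtain ⟨A, hA1, hψ, hlip, hm⟩ := psi_facts hφ
  obtain ⟨c₁, hc₁, t₀, ht₀, hT⟩ := bernstein_rf A (by linarith)
  replace hT : Tail A c₁ t₀ := hT
  set ψ := psiF φ with hψdef
  set m := ∫ z, ψ z * ψ z ∂(gaussianReal 0 1) with hmdef
  set κ := 1 + 2 * |hermiteCoeff φ 1| with hκ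
  have hκ0 : 0 < κ := by positivity
  set C₁ := max C₀ 1 with hC₁
  have hC1 : 1 ≤ C₁ := le_max_right _ _
  set C₃ := A ^ 2 * 5 * 64 ^ 4 * M4 ^ 2 with hC₃
  have hC30 : 0 ≤ C₃ := by positivity
  set Cδ := 1 + 7 * A ^ 2 * C₁ + C₁ + C₁ * C₃ with hCδ
  have hCδ0 : 0 < Cδ := by positivity
  have hK : 0 < K + 1 := by
    have := (data_tail (d := 1) one_pos (hdata 1) (fun _ => 1) (by simp [eNorm]) 0 le_rfl).2
    exact this
  set b := min c₁ (1 / (K + 1) ^ 2) with hb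
  have hb0 : 0 < b := lt_min hc₁ (by positivity)
  set ε := min (min t₀ (1 / 8)) (m / (4 * κ * Cδ)) with hε
  have hε0 : 0 < ε := lt_min (lt_min ht₀ (by norm_num)) (by positivity)
  have hεt : ε ≤ t₀ := (min_le_left _ _).trans (min_le_left _ _)
  have hε8 : ε ≤ 1 / 8 := (min_le_left _ _).trans (min_le_right _ _)
  have hεm : ε ≤ m / (4 * κ * Cδ) := min_le_right _ _
  -- eventual conditions
  have hlog : Tendsto (fun d : ℕ => Real.log (d : ℝ)) atTop atTop :=
    Real.tendsto_log_atTop.comp tendsto_natCast_atTop_atTop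
  have hlog6 : Tendsto (fun d : ℕ => Real.log (d : ℝ) ^ 6 / (1 * (d : ℝ) + 0)) atTop (nhds 0) :=
    (Real.tendsto_pow_log_div_mul_add_atTop 1 0 6 one_ne_zero).comp tendsto_natCast_atTop_atTop
  have ev1 := hlog.eventually_ge_atTop (max 1 (max (20 / c₁) ((4 / b) * (Real.log (6 * C₁ ^ 2) + 2))))
  have ev2 := hlog6.eventually_le_const (by positivity : (0 : ℝ) < ε ^ 2)
  have ev3 := hp.eventually_ge_atTop (1 / ε ^ 2)
  have ev := (ev1.and (ev2.and ev3)).and (eventually_ge_atTop 3)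
  obtain ⟨D, hD⟩ := eventually_atTop.mp ev
  refine ⟨b / 4, by positivity, (4 * κ / m) * Cδ, by positivity, D, fun d hdD => ?_⟩
  obtain ⟨⟨h1, h2, h3⟩, hd3⟩ := hD d hdD
  have hd0 : 0 < d := by omega
  have hd' : (0 : ℝ) < d := by exact_mod_cast hd0
  have hd1 : (1 : ℝ) ≤ d := by exact_mod_cast hd0
  set L := Real.log (d : ℝ) with hL
  have hL1 : 1 ≤ L := (le_max_left _ _).trans h1
  have hL2 : 20 / c₁ ≤ L := ((le_max_left _ _).trans (le_max_right _ _)).trans h1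
  have hL3 : (4 / b) * (Real.log (6 * C₁ ^ 2) + 2) ≤ L := ((le_max_right _ _).trans (le_max_right _ _)).trans h1
  have hL0 : 0 < L := by linarith
  have hdL : (d : ℝ) = Real.exp L := (Real.exp_log hd').symm
  have hεi : 0 < 1 / ε ^ 2 := by positivity
  have hq : 0 < (p d : ℝ) / ((n d : ℝ) * d * L ^ 2) := hεi.trans_le h3
  have hn0 : 0 < n d := by
    rcases Nat.eq_zero_or_pos (n d) with h | h
    · rw [h] at hq; simp at hq
    · exact h
  have hp0 : 0 < p d := by
    rcases Nat.eq_zero_or_pos (p d) with h | h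
    · rw [h] at hq; simp at hq
    · exact h
  have hn1 : (1 : ℝ) ≤ n d := by exact_mod_cast hn0
  have hp' : (0 : ℝ) < p d := by exact_mod_cast hp0
  have hnd : (n d : ℝ) ≤ C₁ * d := (hn d).trans (by gcongr; exact le_max_left _ _)
  obtain ⟨sa, sb, sc, sd, se, sf, sg, sh, si⟩ := arith_scales hd1 hn1 hp' hL1 hC1 hnd
  set T1 := Real.sqrt ((d : ℝ) / p d) * L with hT1
  set T2 := L / Real.sqrt (p d) with hT2
  set u := Real.sqrt ((d : ℝ) * n d / p d) * L with hu
  set w := L ^ 3 / Real.sqrt d with hw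
  have hT10 : 0 ≤ T1 := by positivity
  have hT20 : 0 ≤ T2 := by positivity
  have hu0 : 0 ≤ u := by positivity
  have hw0 : 0 ≤ w := by positivity
  have huε : u ≤ ε := by
    apply (sq_le_sq₀ hu0 hε0.le).mp
    rw [hu, mul_pow, Real.sq_sqrt (by positivity)]
    rw [div_le_div_iff₀ (by positivity) (by positivity)] at h3
    rw [div_mul_eq_mul_div, div_le_iff₀ hp']
    linarith
  have hwε : w ≤ ε := by
    apply (sq_le_sq₀ hw0 hε0.le).mp
    rw [hw, div_pow, Real.sq_sqrt hd'.le]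
    rw [one_mul, add_zero] at h2
    refine le_trans (le_of_eq ?_) h2
    congr 1; ring
  -- events
  have := (hdata d).prob
  set ν := Measure.pi fun _ : Fin (n d) => P d with hν
  set η := T1 + 7 * A ^ 2 / d with hη
  set τ := T2 + C₃ * (L / Real.sqrt d) ^ 3 with hτ
  have E1 := goodData_prob (n := n d) hd0 (hdata d) L hL0.le
  have E2 := sphere_event hA1 hψ hlip hT hd3 hp0 T1 hT10 (by linarith) (by linarith)
  have E3 := entry_event hA1 hψ hT hd0 hp0 ν T2 hT20 (by linarith) L hL0.le (by linarith)
  rw [sh] at E2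
  rw [si] at E3
  have E1' : ((gaussianMatrix (p d) d).prod ν) {ω | ¬ GoodData L ω.2} ≤
      ENNReal.ofReal ((n d : ℝ) ^ 2 * (2 * Real.exp (-(L ^ 2 / (K + 1) ^ 2)))) := by
    have hmp : MeasurePreserving Prod.snd ((gaussianMatrix (p d) d).prod ν) ν := measurePreserving_snd
    have := hmp.measure_preimage (measurable_goodData (d := d) (n := n d) L).compl.nullMeasurableSet
    exact (le_of_eq this).trans E1
  have E2' : ((gaussianMatrix (p d) d).prod ν) {ω | ¬ SphereGood ψ m η ω.1} ≤
      ENNReal.ofReal (3 * ((d : ℝ) ^ (5 * d)) ^ 2 * (2 * Real.exp (-(c₁ * (d * L ^ 2))))) := by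
    have e : {ω : (Fin (p d) → Fin d → ℝ) × (Fin (n d) → Fin d → ℝ) | ¬ SphereGood ψ m η ω.1} =
      {V | ¬ SphereGood ψ m η V} ×ˢ Set.univ := by ext ω; simp
    rw [e, Measure.prod_prod, measure_univ, mul_one]
    exact E2
  set S := {ω : (Fin (p d) → Fin d → ℝ) × (Fin (n d) → Fin d → ℝ) | ∀ xh : Fin d → ℝ, eNorm xh = Real.sqrt d →
            ∀ a : Fin (n d) → ℝ,
              featureMap φ ω.1 xh =
                (fun k => ∑ i, a i * featureMap φ ω.1 (ω.2 i) k) →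
              |(eNorm a) ^ 2 - 1| ≤ (4 * κ / m) * Cδ * (u + w)} with hS
  have hsub : Sᶜ ⊆ ({ω | ¬ GoodData L ω.2} ∪ {ω | ¬ SphereGood ψ m η ω.1}) ∪
      {ω | GoodData L ω.2 ∧ ¬ EntryGood ψ m τ ω.1 ω.2} := by
    intro ω hω
    by_contra hcon
    simp only [Set.mem_union, Set.mem_ofPred_eq, not_or, not_not, not_and] at hcon
    obtain ⟨⟨g1, g2⟩, g3⟩ := hcon
    have g3 := g3 g1
    apply hω
    intro xh hxh a ha
    set δ := Cδ * (u + w) with hδ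
    have hη0 : 0 ≤ η := by positivity
    have hτ0 : 0 ≤ τ := by positivity
    have hAA : 0 ≤ 7 * A ^ 2 := by positivity
    have hηn : η * Real.sqrt (n d) ≤ δ := by
      have e : η * Real.sqrt (n d) = u + 7 * A ^ 2 * (Real.sqrt (n d) / d) := by
        rw [hη, ← sa]; ring
      have f := mul_le_mul_of_nonneg_left se hAA
      rw [e, hδ, hCδ]
      have f1 : 0 ≤ 7 * A ^ 2 * C₁ * u := by positivity
      have f2 : 0 ≤ C₁ * (u + w) := by positivity
      have f3 : 0 ≤ C₁ * C₃ * (u + w) := by positivity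
      linarith
    have hηδ : η ≤ δ := by
      refine le_trans ?_ hηn
      exact le_mul_of_one_le_right hη0 (Real.one_le_sqrt.mpr hn1)
    have hτn : n d * τ ≤ δ := by
      have e : n d * τ = n d * T2 + C₃ * (n d * (L / Real.sqrt d) ^ 3) := by rw [hτ]; ring
      have f := mul_le_mul_of_nonneg_left sf hC30
      rw [e, hδ, hCδ]
      have f1 : 0 ≤ 7 * A ^ 2 * C₁ * (u + w) := by positivity
      have f2 : 0 ≤ C₁ * w := by positivity
      have f3 : 0 ≤ C₁ * C₃ * u := by positivity
      linarith
    have hδ0 : 0 ≤ δ := hη0.trans hηδ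
    have hdet := determ hp0 φ ω.1 ω.2 g1.1 xh hxh a ha m δ η τ hη0 hτ0 hηδ hηn hτn
      ((g2.1 xh hxh).trans hηδ) g2.2 g3.1 g3.2
    have hδm : κ * δ ≤ m / 2 := by
      rw [le_div_iff₀ (by positivity)] at hεm
      calc κ * δ = κ * Cδ * (u + w) := by rw [hδ]; ring
        _ ≤ κ * Cδ * (ε + ε) := by gcongr
        _ ≤ m / 2 := by linarith
    have := determ_concl hm (sq_nonneg (eNorm a)) hδm hdet hδ0 hκ0.le
    rw [mul_assoc]
    exact this
  have hbad : ((gaussianMatrix (p d) d).prod ν) Sᶜ ≤ ENNReal.ofReal (2 * Real.exp (-(b / 4) * L ^ 2)) := by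
    refine (measure_mono hsub).trans ((measure_union_le _ _).trans
      ((add_le_add ((measure_union_le _ _).trans (add_le_add E1' E2')) E3).trans ?_))
    rw [← ENNReal.ofReal_add (by positivity) (by positivity), ← ENNReal.ofReal_add (by positivity) (by positivity)]
    apply ENNReal.ofReal_le_ofReal
    have := fail_bound (k := 1 / (K + 1) ^ 2) hd1 hdL (by linarith) hnd hC1 hb0 (min_le_left _ _) (min_le_right _ _) hL1 hL2 hL3 d rfl
    rw [mul_one_div] at this
    exact this
  have huniv : (1 : ENNReal) ≤ ((gaussianMatrix (p d) d).prod ν) S + ((gaussianMatrix (p d) d).prod ν) Sᶜ := by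
    rw [← measure_univ (μ := (gaussianMatrix (p d) d).prod ν), ← Set.union_compl_self S]
    exact measure_union_le _ _
  rw [tsub_le_iff_right]
  exact huniv.trans (by gcongr)
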